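/- arXiv:1709.04508 — 6 statements merged into one kernel-verified Lean document; each statement's English description precedes it below -/
import Mathlib

section
/- Let n>1 and let 𝔸 be a first-order (k=1) homogeneous linear constant-coefficient differential operator on ℝⁿ from V to W. Suppose there exists c>0 such that ‖u‖_{L^{n/(n−1)}(B)} ≤ c ( ‖𝔸u‖_{L¹(B)} + ‖u‖_{L¹(B)} ) for all u ∈ C^∞(cl(B), V). Then for every 1 ≤ q < n/(n−1), the set F = { u ∈ C^∞(cl(B), V) : ‖u‖_{L¹(B)} + ‖𝔸u‖_{L¹(B)} ≤ 1 } is totally bounded as a subset of L^q(B, V). -/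
noncomputable section

open MeasureTheory Metric
open scoped ENNReal RealInnerProductSpace

/-- Euclidean space `ℝⁿ`. -/
abbrev Euc (n : ℕ) : Type := EuclideanSpace ℝ (Fin n)

/-- The coefficient datum of a homogeneous `k`-th order linear constant-coefficient
differential operator `𝔸` from `V` to `W` on `ℝⁿ`: a linear map acting on the space of
(values of) `k`-th derivatives, so that `𝔸 u (x) = A (D^k u (x))`. -/
abbrev OpCoeff (n k : ℕ) (V W : Type*) [NormedAddCommGroup V] [NormedSpace ℝ V]
    [NormedAddCommGroup W] [NormedSpace ℝ W] : Type _ :=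
  ContinuousMultilinearMap ℝ (fun _ : Fin k => Euc n) V →L[ℝ] W

variable {n k : ℕ} {V W : Type*}
  [NormedAddCommGroup V] [InnerProductSpace ℝ V] [FiniteDimensional ℝ V]
  [NormedAddCommGroup W] [InnerProductSpace ℝ W] [FiniteDimensional ℝ W]

/-- `𝔸 u`, the operator applied to `u : ℝⁿ → V`. -/
def opApply (A : OpCoeff n k V W) (u : Euc n → V) (x : Euc n) : W :=
  A (iteratedFDeriv ℝ k u x)

/-- The symmetric tensor `v ⊗^k ξ`, i.e. the `k`-linear map `(e₁,…,e_k) ↦ (∏ᵢ ⟪ξ,eᵢ⟫) • v`. -/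
def symTensor (n k : ℕ) {V : Type*} [NormedAddCommGroup V] [NormedSpace ℝ V]
    (ξ : Euc n) (v : V) : ContinuousMultilinearMap ℝ (fun _ : Fin k => Euc n) V :=
  (ContinuousMultilinearMap.mkPiRing ℝ (Fin k) v).compContinuousLinearMap
    (fun _ => innerSL ℝ ξ)

/-- The (real) symbol `𝔸[ξ] v = A (v ⊗^k ξ)`. -/
def symbol (A : OpCoeff n k V W) (ξ : Euc n) (v : V) : W :=
  A (symTensor n k ξ v)

/-- Ellipticity: `𝔸[ξ]` is injective for every real `ξ ≠ 0`. -/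
def IsElliptic (A : OpCoeff n k V W) : Prop :=
  ∀ ξ : Euc n, ξ ≠ 0 → Function.Injective (symbol A ξ)

/-- Cancellation: `⋂_{ξ ≠ 0} 𝔸[ξ](V) = {0}`. -/
def IsCancelling (A : OpCoeff n k V W) : Prop :=
  (⋂ ξ ∈ {ξ : Euc n | ξ ≠ 0}, Set.range (symbol A ξ)) = {0}

/-- The scalar `ℝ`-multilinear map `(e₁,…,e_k) ↦ ∏ᵢ (⟪η₁,eᵢ⟫ + i ⟪η₂,eᵢ⟫) ∈ ℂ`,
the building block for the complexified symbol at `ξ = η₁ + i η₂`. -/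
def cxKernel (n k : ℕ) (η₁ η₂ : Euc n) :
    ContinuousMultilinearMap ℝ (fun _ : Fin k => Euc n) ℂ :=
  ((ContinuousMultilinearMap.mkPiRing ℂ (Fin k) (1 : ℂ)).restrictScalars ℝ).compContinuousLinearMap
    (fun _ => Complex.ofRealCLM.comp (innerSL ℝ η₁) + Complex.I • Complex.ofRealCLM.comp (innerSL ℝ η₂))

/-- Real part of the complexified tensor `(v₁ + i v₂) ⊗^k (η₁ + i η₂)`. -/
def cxSymTensorRe (n k : ℕ) {V : Type*} [NormedAddCommGroup V] [NormedSpace ℝ V]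
    (η₁ η₂ : Euc n) (v₁ v₂ : V) : ContinuousMultilinearMap ℝ (fun _ : Fin k => Euc n) V :=
  (Complex.reCLM.compContinuousMultilinearMap (cxKernel n k η₁ η₂)).smulRight v₁
    - (Complex.imCLM.compContinuousMultilinearMap (cxKernel n k η₁ η₂)).smulRight v₂

/-- Imaginary part of the complexified tensor `(v₁ + i v₂) ⊗^k (η₁ + i η₂)`. -/
def cxSymTensorIm (n k : ℕ) {V : Type*} [NormedAddCommGroup V] [NormedSpace ℝ V]
    (η₁ η₂ : Euc n) (v₁ v₂ : V) : ContinuousMultilinearMap ℝ (fun _ : Fin k => Euc n) V :=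
  (Complex.imCLM.compContinuousMultilinearMap (cxKernel n k η₁ η₂)).smulRight v₁
    + (Complex.reCLM.compContinuousMultilinearMap (cxKernel n k η₁ η₂)).smulRight v₂

/-- ℂ-ellipticity: the complexified symbol `𝔸[η₁ + i η₂]` is injective on `V + iV` for
every nonzero complex frequency `η₁ + i η₂`. -/
def IsCElliptic (A : OpCoeff n k V W) : Prop :=
  ∀ η₁ η₂ : Euc n, ∀ v₁ v₂ : V, (η₁, η₂) ≠ 0 →
    A (cxSymTensorRe n k η₁ η₂ v₁ v₂) = 0 → A (cxSymTensorIm n k η₁ η₂ v₁ v₂) = 0 →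
      v₁ = 0 ∧ v₂ = 0

/-- The null-space of `𝔸`: smooth maps `u : ℝⁿ → V` with `𝔸 u = 0`. -/
def nullSpace (A : OpCoeff n k V W) : Set (Euc n → V) :=
  {u | ContDiff ℝ (⊤ : ℕ∞) u ∧ ∀ x, opApply A u x = 0}

section Kernel
open scoped FourierTransform SchwartzMap

/-- The cosine transform. -/
def cosT (m : Euc n → ℝ) (x : Euc n) : ℝ := ∫ ξ, Real.cos (2 * Real.pi * ⟪ξ, x⟫) * m ξ

lemma re_fourier (m : Euc n → ℝ) (hm : Integrable m) (x : Euc n) :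
    (𝓕 (fun ξ => (m ξ : ℂ)) x).re = cosT m x := by
  rw [Real.fourier_eq, cosT, ← RCLike.re_eq_complex_re, ← integral_re]
  · congr 1
    ext ξ
    rw [Circle.smul_def, smul_eq_mul, Real.fourierChar_apply]
    simp only [RCLike.re_eq_complex_re, Complex.mul_re, Complex.ofReal_re, Complex.ofReal_im,
      mul_zero, sub_zero]
    rw [Complex.exp_ofReal_mul_I_re]
    congr 1
    rw [← Real.cos_neg]; congr 1; ring
  · have := (Real.fourierIntegral_convergent_iff (f := fun ξ => (m ξ : ℂ)) (μ := volume) x).2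
      hm.ofReal
    simpa using this

lemma exists_schwartz (m : Euc n → ℝ) (hm : ContDiff ℝ (⊤ : ℕ∞) m) (hc : HasCompactSupport m) :
    ∃ f : 𝓢(Euc n, ℂ), ∀ x, f x = (m x : ℂ) := by
  have h1 : ContDiff ℝ (⊤ : ℕ∞) (fun x => (m x : ℂ)) := Complex.ofRealCLM.contDiff.comp hm
  have h2 : HasCompactSupport (fun x => (m x : ℂ)) := hc.comp_left (g := fun t : ℝ => (t : ℂ)) (by simp)
  exact ⟨h2.toSchwartzMap h1, fun x => by simp⟩

lemma ker_scalar (m : Euc n → ℝ) (hm : ContDiff ℝ (⊤ : ℕ∞) m) (hc : HasCompactSupport m) :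
    ∃ g : Euc n → ℝ, ContDiff ℝ 1 g ∧ Integrable g ∧
      ∀ x e, fderiv ℝ g x e = cosT (fun ξ => ⟪ξ, e⟫ * m ξ) x := by
  obtain ⟨f, hf⟩ := exists_schwartz m hm hc
  let g : Euc n → ℝ := fun x => Complex.reCLM ((Complex.I / (2 * Real.pi)) * (𝓕 f) x)
  refine ⟨g, ?_, ?_, ?_⟩
  · exact Complex.reCLM.contDiff.comp (contDiff_const.mul ((𝓕 f).smooth 1))
  · exact Complex.reCLM.integrable_comp ((𝓕 f).integrable.const_mul _)
  · intro x e
    have hd : DifferentiableAt ℝ (𝓕 f : 𝓢(Euc n, ℂ)) x := (𝓕 f).differentiableAt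
    have hF : HasFDerivAt g (Complex.reCLM.comp ((Complex.I / (2 * Real.pi)) •
        fderiv ℝ (𝓕 f : 𝓢(Euc n, ℂ)) x)) x := by
      exact Complex.reCLM.hasFDerivAt.comp x (hd.hasFDerivAt.const_mul _)
    rw [hF.fderiv]
    have h1 : fderiv ℝ (𝓕 f : 𝓢(Euc n, ℂ)) x e = (LineDeriv.lineDerivOp e (𝓕 f)) x := by
      rw [SchwartzMap.lineDerivOp_apply_eq_fderiv]
    have ht : Function.HasTemperateGrowth (fun y : Euc n => (inner ℝ y e : ℝ)) :=
      ((innerSL ℝ).flip e).hasTemperateGrowth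
    rw [ContinuousLinearMap.comp_apply, _root_.smul_apply, h1,
      SchwartzMap.lineDerivOp_fourier_eq]
    rw [← re_fourier]
    · rw [FourierTransform.fourier_smul]
      have h2 : (𝓕 ((SchwartzMap.smulLeftCLM ℂ fun x : Euc n => (inner ℝ x e : ℝ)) f)) x
        = 𝓕 (fun ξ => ((inner ℝ ξ e * m ξ : ℝ) : ℂ)) x := by
        rw [SchwartzMap.fourier_coe]
        refine congrArg (fun F : Euc n → ℂ => 𝓕 F x) (funext fun ξ => ?_)
        simp [ht, hf]
      rw [_root_.smul_apply, h2]
      simp only [smul_eq_mul, Complex.reCLM_apply]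
      rw [← mul_assoc]
      have : (Complex.I / (2 * Real.pi)) * -(2 * Real.pi * Complex.I) = 1 := by
        have : (Real.pi : ℂ) ≠ 0 := by exact_mod_cast Real.pi_ne_zero
        field_simp
        simp
      rw [this, one_mul]
    · exact Continuous.integrable_of_hasCompactSupport (by have := hm.continuous; fun_prop) hc.mul_left

lemma cosT_bdd (m : Euc n → ℝ) (hm : Integrable m) (x : Euc n) : |cosT m x| ≤ ∫ ξ, ‖m ξ‖ := by
  rw [cosT, ← Real.norm_eq_abs]
  refine norm_integral_le_of_norm_le hm.norm (Filter.Eventually.of_forall fun ξ => ?_)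
  rw [norm_mul]
  exact mul_le_of_le_one_left (norm_nonneg _) (Real.abs_cos_le_one _)

lemma cosT_integrable (m : Euc n → ℝ) (hm : ContDiff ℝ (⊤ : ℕ∞) m) (hc : HasCompactSupport m) :
    Integrable (cosT m) ∧ Continuous (cosT m) ∧ ∫ x, cosT m x = m 0 := by
  obtain ⟨f, hf⟩ := exists_schwartz m hm hc
  have hi : Integrable m := hm.continuous.integrable_of_hasCompactSupport hc
  have e : cosT m = fun x => ((𝓕 f) x).re := by
    ext x
    rw [← re_fourier m hi, SchwartzMap.fourier_coe]
    refine congrArg (fun F : Euc n → ℂ => (𝓕 F x).re) (funext fun ξ => ?_)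
    simp [hf]
  have hI := (𝓕 f).integrable (μ := volume)
  refine ⟨?_, ?_, ?_⟩
  · rw [e]; exact hI.re
  · rw [e]; exact Complex.continuous_re.comp (𝓕 f).continuous
  · rw [e]
    have h2 : 𝓕⁻ (𝓕 (f : Euc n → ℂ)) (0 : Euc n) = f 0 :=
      Integrable.fourierInv_fourier_eq f.integrable
        (by rw [← SchwartzMap.fourier_coe]; exact hI) f.continuous.continuousAt
    rw [Real.fourierInv_eq] at h2
    simp only [inner_zero_right, AddChar.map_zero_eq_one, one_smul] at h2
    rw [← SchwartzMap.fourier_coe] at h2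
    have := integral_re hI
    simp only [RCLike.re_eq_complex_re] at this
    rw [this, h2, hf]; simp

lemma cosT_lip (m : Euc n → ℝ) (hm : Continuous m) (hc : HasCompactSupport m) :
    ∃ L : ℝ, 0 ≤ L ∧ ∀ x y, |cosT m x - cosT m y| ≤ L * ‖x - y‖ := by
  have hi : Integrable m := hm.integrable_of_hasCompactSupport hc
  have hi2 : Integrable (fun ξ => ‖ξ‖ * ‖m ξ‖) :=
    Continuous.integrable_of_hasCompactSupport (by fun_prop) hc.norm.mul_left
  have hI : ∀ x : Euc n, Integrable (fun ξ => Real.cos (2 * Real.pi * ⟪ξ, x⟫) * m ξ) := fun x =>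
    Continuous.integrable_of_hasCompactSupport (by fun_prop) hc.mul_left
  refine ⟨2 * Real.pi * ∫ ξ, ‖ξ‖ * ‖m ξ‖, by positivity, fun x y => ?_⟩
  rw [cosT, cosT, ← integral_sub (hI x) (hI y), ← Real.norm_eq_abs]
  have : 2 * Real.pi * (∫ ξ, ‖ξ‖ * ‖m ξ‖) * ‖x - y‖
    = ∫ ξ, 2 * Real.pi * ‖x - y‖ * (‖ξ‖ * ‖m ξ‖) := by
    rw [integral_const_mul]; ring
  rw [this]
  refine norm_integral_le_of_norm_le (hi2.const_mul _) (Filter.Eventually.of_forall fun ξ => ?_)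
  rw [← sub_mul, norm_mul]
  have h1 : ‖Real.cos (2 * Real.pi * ⟪ξ, x⟫) - Real.cos (2 * Real.pi * ⟪ξ, y⟫)‖
      ≤ 2 * Real.pi * (‖ξ‖ * ‖x - y‖) := by
    calc _ ≤ |2 * Real.pi * ⟪ξ, x⟫ - 2 * Real.pi * ⟪ξ, y⟫| := by
            have := Real.lipschitzWith_cos.dist_le_mul (2 * Real.pi * ⟪ξ, x⟫) (2 * Real.pi * ⟪ξ, y⟫)
            simpa [Real.dist_eq] using this
      _ = 2 * Real.pi * |⟪ξ, x - y⟫| := by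
            rw [inner_sub_right, ← mul_sub, abs_mul, abs_of_pos (by positivity)]
      _ ≤ _ := by gcongr; exact abs_real_inner_le_norm _ _
  calc _ ≤ 2 * Real.pi * (‖ξ‖ * ‖x - y‖) * ‖m ξ‖ := by gcongr
    _ = _ := by ring

lemma cosT_scale (m : Euc n → ℝ) (x : Euc n) :
    cosT (fun ξ => m ((2:ℝ)⁻¹ • ξ)) x = 2 ^ n * cosT m ((2:ℝ) • x) := by
  have := Measure.integral_comp_smul (volume : Measure (Euc n))
    (fun ξ => Real.cos (2 * Real.pi * ⟪ξ, (2:ℝ) • x⟫) * m ξ) (2:ℝ)⁻¹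
  rw [cosT, cosT]
  simp only [inner_smul_left, inner_smul_right] at this ⊢
  simp only [finrank_euclideanSpace, Fintype.card_fin, conj_trivial] at this
  rw [inv_pow, inv_inv, abs_of_pos (by positivity), smul_eq_mul] at this
  rw [← this]
  congr 1; ext ξ; congr 3
  ring
end Kernel

set_option linter.unusedSectionVars false
section Kernel2

/-- The symbol of the first-order operator `u ↦ A1 (Du)`, linear in the frequency. -/
def symL (A1 : (Euc n →L[ℝ] V) →L[ℝ] W) : Euc n →ₗ[ℝ] (V →L[ℝ] W) where
  toFun ξ := A1.comp (ContinuousLinearMap.smulRightL ℝ (Euc n) V (innerSL ℝ ξ))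
  map_add' ξ η := by ext v; simp
  map_smul' c ξ := by ext v; simp

lemma symL_apply (A1 : (Euc n →L[ℝ] V) →L[ℝ] W) (ξ : Euc n) (v : V) :
    symL A1 ξ v = A1 ((innerSL ℝ ξ).smulRight v) := rfl

/-- The adjoint symbol. -/
def symAdj (A1 : (Euc n →L[ℝ] V) →L[ℝ] W) : Euc n →ₗ[ℝ] (W →L[ℝ] V) where
  toFun ξ := ContinuousLinearMap.adjoint (symL A1 ξ)
  map_add' ξ η := by simp
  map_smul' c ξ := by simp

lemma left_inv (A1 : (Euc n →L[ℝ] V) →L[ℝ] W)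
    (hA : ∀ ξ : Euc n, ξ ≠ 0 → ∀ v, symL A1 ξ v = 0 → v = 0) :
    ∃ M : Euc n → (W →L[ℝ] V), (∀ ξ, ξ ≠ 0 → ContDiffAt ℝ (⊤ : ℕ∞) M ξ) ∧
      ∀ ξ, ξ ≠ 0 → ∀ v, M ξ (symL A1 ξ v) = v := by
  have hS : ContDiff ℝ (⊤ : ℕ∞) (symL A1) := (LinearMap.toContinuousLinearMap (symL A1)).contDiff
  have hT : ContDiff ℝ (⊤ : ℕ∞) (symAdj A1) := (LinearMap.toContinuousLinearMap (symAdj A1)).contDiff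
  have hunit : ∀ ξ : Euc n, ξ ≠ 0 → IsUnit ((symAdj A1 ξ).comp (symL A1 ξ) : V →L[ℝ] V) := by
    intro ξ hξ
    rw [ContinuousLinearMap.isUnit_iff_bijective]
    have hinj : Function.Injective ((symAdj A1 ξ).comp (symL A1 ξ) : V →L[ℝ] V) := by
      rw [injective_iff_map_eq_zero]
      intro v hv
      apply hA ξ hξ
      have : inner ℝ ((symAdj A1 ξ) (symL A1 ξ v)) v = 0 := by
        have : (symAdj A1 ξ) (symL A1 ξ v) = 0 := hv
        rw [this, inner_zero_left]
      change inner ℝ (ContinuousLinearMap.adjoint (symL A1 ξ) (symL A1 ξ v)) v = 0 at this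
      rw [ContinuousLinearMap.adjoint_inner_left] at this
      exact inner_self_eq_zero.1 this
    exact ⟨hinj, LinearMap.surjective_of_injective
      (f := (((symAdj A1 ξ).comp (symL A1 ξ) : V →L[ℝ] V) : V →ₗ[ℝ] V)) hinj⟩
  refine ⟨fun ξ => (Ring.inverse ((symAdj A1 ξ).comp (symL A1 ξ) : V →L[ℝ] V)).comp (symAdj A1 ξ),
    ?_, ?_⟩
  · intro ξ hξ
    refine ContDiffAt.clm_comp ?_ hT.contDiffAt
    obtain ⟨U, hU⟩ := hunit ξ hξ
    have h1 : ContDiffAt ℝ (⊤ : ℕ∞) Ring.inverse ((symAdj A1 ξ).comp (symL A1 ξ) : V →L[ℝ] V) := by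
      rw [← hU]; exact contDiffAt_ringInverse ℝ U
    exact h1.comp ξ (hT.contDiffAt.clm_comp hS.contDiffAt)
  · intro ξ hξ v
    have := Ring.inverse_mul_cancel _ (hunit ξ hξ)
    exact congrArg (fun T : V →L[ℝ] V => T v) this

set_option maxHeartbeats 1000000 in
lemma kernel_exists (A1 : (Euc n →L[ℝ] V) →L[ℝ] W)
    (hA : ∀ ξ : Euc n, ξ ≠ 0 → ∀ v, symL A1 ξ v = 0 → v = 0) :
    ∃ (G : Euc n → (W →L[ℝ] V)) (φ : Euc n → ℝ), ContDiff ℝ 1 G ∧ Integrable G ∧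
      Continuous φ ∧ Integrable φ ∧ ∫ x, φ x = 1 ∧ (∃ C, 0 ≤ C ∧ ∀ x, |φ x| ≤ C) ∧
      (∃ L, 0 ≤ L ∧ ∀ x y, |φ x - φ y| ≤ L * ‖x - y‖) ∧
      ∀ x v, ∑ i, (fderiv ℝ G x (EuclideanSpace.basisFun (Fin n) ℝ i))
        (symL A1 (EuclideanSpace.basisFun (Fin n) ℝ i) v) = (2 ^ n * φ ((2:ℝ) • x) - φ x) • v := by
  obtain ⟨M, hM1, hM2⟩ := left_inv A1 hA
  let ψ : ContDiffBump (0 : Euc n) := ⟨1, 2, by norm_num, by norm_num⟩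
  have hψ : ContDiff ℝ (⊤ : ℕ∞) ψ := ψ.contDiff
  have hψc : HasCompactSupport ψ := ψ.hasCompactSupport
  let χ : Euc n → ℝ := fun ξ => ψ ((2:ℝ)⁻¹ • ξ) - ψ ξ
  have hψ2c : HasCompactSupport (fun ξ : Euc n => ψ ((2:ℝ)⁻¹ • ξ)) :=
    hψc.comp_smul (by norm_num)
  have hψ2 : ContDiff ℝ (⊤ : ℕ∞) (fun ξ : Euc n => ψ ((2:ℝ)⁻¹ • ξ)) :=
    hψ.comp (contDiff_const_smul _)
  have hχ : ContDiff ℝ (⊤ : ℕ∞) χ := hψ2.sub hψ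
  have hχc : HasCompactSupport χ := hψ2c.sub hψc
  have hχ0 : ∀ ξ ∈ ball (0 : Euc n) 1, χ ξ = 0 := by
    intro ξ hξ
    rw [mem_ball_zero_iff] at hξ
    have h1 : ψ ξ = 1 := ψ.one_of_mem_closedBall (by simpa [ψ] using hξ.le)
    have h2 : ψ ((2:ℝ)⁻¹ • ξ) = 1 := ψ.one_of_mem_closedBall (by
      simp only [mem_closedBall_zero_iff, norm_smul, ψ]
      norm_num; linarith)
    simp [χ, h1, h2]
  obtain ⟨bV, -⟩ : ∃ b : OrthonormalBasis (Fin (Module.finrank ℝ V)) ℝ V, b = b :=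
    ⟨stdOrthonormalBasis ℝ V, rfl⟩
  obtain ⟨bW, -⟩ : ∃ b : OrthonormalBasis (Fin (Module.finrank ℝ W)) ℝ W, b = b :=
    ⟨stdOrthonormalBasis ℝ W, rfl⟩
  let e := EuclideanSpace.basisFun (Fin n) ℝ
  let m := fun a b ξ => χ ξ * inner ℝ (bV a) (M ξ (bW b))
  have hm : ∀ a b, ContDiff ℝ (⊤ : ℕ∞) (m a b) := by
    intro a b
    rw [contDiff_iff_contDiffAt]
    intro ξ
    by_cases hξ : ξ = 0
    · have : m a b =ᶠ[nhds ξ] fun _ => 0 := by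
        rw [hξ]
        filter_upwards [ball_mem_nhds (0 : Euc n) one_pos] with η hη
        simp [m, hχ0 η hη]
      exact contDiffAt_const.congr_of_eventuallyEq this
    · exact hχ.contDiffAt.mul (contDiffAt_const.inner ℝ ((hM1 ξ hξ).clm_apply contDiffAt_const))
  have hmc : ∀ a b, HasCompactSupport (m a b) := fun a b => hχc.mul_right
  choose g hg1 hg2 hg3 using fun a b => ker_scalar (m a b) (hm a b) (hmc a b)
  let T : Fin (Module.finrank ℝ V) → Fin (Module.finrank ℝ W) → (W →L[ℝ] V) :=
    fun a b => (innerSL ℝ (bW b)).smulRight (bV a)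
  obtain ⟨i1, i2, i3⟩ := cosT_integrable ψ hψ hψc
  refine ⟨fun x => ∑ a, ∑ b, g a b x • T a b, cosT ψ, ?_, ?_, i2, i1, ?_, ?_, ?_, ?_⟩
  · exact ContDiff.sum fun a _ => ContDiff.sum fun b _ => (hg1 a b).smul contDiff_const
  · refine integrable_finsetSum (f := fun a x => ∑ b, g a b x • T a b) _ fun a _ => ?_
    refine integrable_finsetSum (f := fun b x => g a b x • T a b) _ fun b _ => ?_
    exact (hg2 a b).smul_const _
  · rw [i3]; exact ψ.one_of_mem_closedBall (mem_closedBall_self ψ.rIn_pos.le)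
  · exact ⟨_, by positivity, cosT_bdd ψ (hψ.continuous.integrable_of_hasCompactSupport hψc)⟩
  · exact cosT_lip ψ hψ.continuous hψc
  · intro x v
    have hd : HasFDerivAt (fun x => ∑ a, ∑ b, g a b x • T a b)
        (∑ a, ∑ b, (fderiv ℝ (g a b) x).smulRight (T a b)) x := by
      refine HasFDerivAt.fun_sum fun a _ => HasFDerivAt.fun_sum fun b _ => ?_
      have h0 := (((hg1 a b).differentiable (by norm_num)) x).hasFDerivAt
      exact h0.smul_const (T a b)
    rw [hd.fderiv]
    have key : ∀ a, ∑ i, ∑ b, cosT (fun ξ => ⟪ξ, e i⟫ * m a b ξ) x * ⟪bW b, symL A1 (e i) v⟫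
        = cosT χ x * ⟪bV a, v⟫ := by
      intro a
      have hIib : ∀ i b, Integrable (fun ξ => Real.cos (2 * Real.pi * ⟪ξ, x⟫) *
          (⟪ξ, e i⟫ * m a b ξ) * ⟪bW b, symL A1 (e i) v⟫) := by
        intro i b
        have := (hm a b).continuous
        exact Continuous.integrable_of_hasCompactSupport (by fun_prop)
          ((hmc a b).mul_left.mul_left.mul_right)
      simp only [cosT]
      simp only [← integral_mul_const]
      rw [Finset.sum_congr rfl fun i _ => (integral_finsetSum _ fun b _ => hIib i b).symm]
      rw [← integral_finsetSum _ fun i _ => integrable_finsetSum _ fun b _ => hIib i b]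
      congr 1
      ext ξ
      by_cases hξ : ξ = 0
      · have : χ ξ = 0 := hχ0 ξ (by simp [hξ])
        simp [m, this]
      · have h1 : ∑ i, ⟪ξ, e i⟫ • symL A1 (e i) v = symL A1 ξ v := by
          conv_rhs => rw [← e.sum_repr' ξ, map_sum]
          simp only [map_smul, _root_.sum_apply, _root_.smul_apply]
          refine Finset.sum_congr rfl fun i _ => ?_
          rw [real_inner_comm]
        have h2 : ∀ w, ∑ b, ⟪bV a, M ξ (bW b)⟫ * ⟪bW b, w⟫ = ⟪bV a, M ξ w⟫ := by
          intro w
          conv_rhs => rw [← bW.sum_repr' w, map_sum, inner_sum]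
          refine Finset.sum_congr rfl fun i _ => ?_
          rw [map_smul, inner_smul_right, mul_comm]
        calc _ = ∑ i, Real.cos (2 * Real.pi * ⟪ξ, x⟫) * χ ξ * (⟪ξ, e i⟫ *
                ∑ b, ⟪bV a, M ξ (bW b)⟫ * ⟪bW b, symL A1 (e i) v⟫) := by
              refine Finset.sum_congr rfl fun i _ => ?_
              rw [Finset.mul_sum, Finset.mul_sum]
              refine Finset.sum_congr rfl fun b _ => ?_
              simp only [m]; ring
          _ = Real.cos (2 * Real.pi * ⟪ξ, x⟫) * χ ξ * ⟪bV a, v⟫ := by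
              rw [← Finset.mul_sum]
              congr 1
              simp only [h2]
              conv_rhs => rw [← hM2 ξ hξ v, ← h1, map_sum, inner_sum]
              refine Finset.sum_congr rfl fun i _ => ?_
              rw [map_smul, inner_smul_right]
    have hχT : cosT χ x = 2 ^ n * cosT ψ ((2:ℝ) • x) - cosT ψ x := by
      rw [← cosT_scale]
      simp only [cosT, χ, mul_sub]
      have := hψ.continuous
      exact integral_sub
        (Continuous.integrable_of_hasCompactSupport (by fun_prop) hψ2c.mul_left)
        (Continuous.integrable_of_hasCompactSupport (by fun_prop) hψc.mul_left)
    rw [← hχT]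
    calc _ = ∑ i, ∑ a, (∑ b, cosT (fun ξ => ⟪ξ, e i⟫ * m a b ξ) x * ⟪bW b, symL A1 (e i) v⟫) • bV a := by
          refine Finset.sum_congr rfl fun i _ => ?_
          simp only [_root_.sum_apply, ContinuousLinearMap.smulRight_apply, hg3,
            _root_.smul_apply, T, innerSL_apply_apply, Finset.sum_smul, smul_smul]
          rfl
      _ = ∑ a, (cosT χ x * ⟪bV a, v⟫) • bV a := by
          rw [Finset.sum_comm]
          refine Finset.sum_congr rfl fun a _ => ?_
          rw [← Finset.sum_smul, key]
      _ = _ := by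
          conv_rhs => rw [← bV.sum_repr' v, Finset.smul_sum]
          simp only [smul_smul]
end Kernel2

section Mollify

/-- Mollification of `v` with `t ^ n * φ (t • ·)`. -/
def molT (φ : Euc n → ℝ) (t : ℝ) (v : Euc n → V) (x : Euc n) : V :=
  ∫ y, (t ^ n * φ (t • (x - y))) • v y

lemma molT_integrable (φ : Euc n → ℝ) (hφ : Continuous φ) (t : ℝ) (v : Euc n → V)
    (hv : Continuous v) (hvc : HasCompactSupport v) (x : Euc n) :
    Integrable (fun y => (t ^ n * φ (t • (x - y))) • v y) :=
  Continuous.integrable_of_hasCompactSupport (by fun_prop) hvc.smul_left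

lemma molT_bdd (φ : Euc n → ℝ) {C : ℝ} (hC : ∀ x, |φ x| ≤ C) {t : ℝ} (ht : 0 < t)
    (v : Euc n → V) (hvi : Integrable v) (x : Euc n) :
    ‖molT φ t v x‖ ≤ t ^ n * C * ∫ y, ‖v y‖ := by
  rw [molT, ← integral_const_mul]
  refine norm_integral_le_of_norm_le (hvi.norm.const_mul _) (Filter.Eventually.of_forall fun y => ?_)
  rw [norm_smul, norm_mul, Real.norm_eq_abs (φ _), Real.norm_of_nonneg (by positivity)]
  gcongr
  exact hC _

lemma molT_lip (φ : Euc n → ℝ) (hφ : Continuous φ) {L : ℝ}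
    (hL : ∀ x y, |φ x - φ y| ≤ L * ‖x - y‖) {t : ℝ} (ht : 0 < t)
    (v : Euc n → V) (hv : Continuous v) (hvc : HasCompactSupport v) (x x' : Euc n) :
    ‖molT φ t v x - molT φ t v x'‖ ≤ (t ^ n * (L * t) * ∫ y, ‖v y‖) * ‖x - x'‖ := by
  have hvi : Integrable v := hv.integrable_of_hasCompactSupport hvc
  rw [molT, molT, ← integral_sub (molT_integrable φ hφ t v hv hvc x)
    (molT_integrable φ hφ t v hv hvc x')]
  have : (t ^ n * (L * t) * ∫ y, ‖v y‖) * ‖x - x'‖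
    = ∫ y, t ^ n * (L * t) * ‖x - x'‖ * ‖v y‖ := by
    rw [integral_const_mul]; ring
  rw [this]
  refine norm_integral_le_of_norm_le (hvi.norm.const_mul _) (Filter.Eventually.of_forall fun y => ?_)
  rw [← sub_smul, norm_smul, ← mul_sub, norm_mul, Real.norm_eq_abs (φ _ - φ _),
    Real.norm_of_nonneg (by positivity)]
  have h1 := hL (t • (x - y)) (t • (x' - y))
  rw [← smul_sub, norm_smul, Real.norm_of_nonneg ht.le, sub_sub_sub_cancel_right] at h1
  calc _ ≤ t ^ n * (L * (t * ‖x - x'‖)) * ‖v y‖ := by gcongr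
    _ = _ := by ring

lemma molT_cont (φ : Euc n → ℝ) (hφ : Continuous φ) {L : ℝ} (hL0 : 0 ≤ L)
    (hL : ∀ x y, |φ x - φ y| ≤ L * ‖x - y‖) {t : ℝ} (ht : 0 < t)
    (v : Euc n → V) (hv : Continuous v) (hvc : HasCompactSupport v) :
    Continuous (molT φ t v) := by
  refine (LipschitzWith.of_dist_le_mul (K := ⟨t ^ n * (L * t) * ∫ y, ‖v y‖, ?_⟩) ?_).continuous
  · have : 0 ≤ ∫ y, ‖v y‖ := integral_nonneg fun _ => norm_nonneg _
    positivity
  · intro x y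
    rw [dist_eq_norm, dist_eq_norm]
    exact molT_lip φ hφ hL ht v hv hvc x y

lemma molT_eq (φ : Euc n → ℝ) {t : ℝ} (ht : 0 < t) (v : Euc n → V) (x : Euc n) :
    molT φ t v x = ∫ z, φ z • v (x - t⁻¹ • z) := by
  rw [molT, ← integral_sub_left_eq_self _ volume x]
  have := Measure.integral_comp_smul (volume : Measure (Euc n))
    (fun z => φ z • v (x - t⁻¹ • z)) t
  simp only [finrank_euclideanSpace, Fintype.card_fin] at this
  rw [abs_of_pos (by positivity)] at this
  have h2 : (∫ z, φ z • v (x - t⁻¹ • z)) = t ^ n • ∫ z, φ (t • z) • v (x - t⁻¹ • (t • z)) := by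
    rw [this, smul_smul, mul_inv_cancel₀ (by positivity), one_smul]
  rw [h2, ← integral_smul]
  congr 1; ext z
  rw [sub_sub_cancel, smul_smul, smul_smul, inv_mul_cancel₀ ht.ne', one_smul]

lemma molT_tendsto (φ : Euc n → ℝ) (hφi : Integrable φ)
    (hφ1 : ∫ x, φ x = 1) (v : Euc n → V) (hv : Continuous v) (hvc : HasCompactSupport v)
    (x : Euc n) (t : ℕ → ℝ) (ht : ∀ k, 0 < t k) (htt : Filter.Tendsto t Filter.atTop Filter.atTop) :
    Filter.Tendsto (fun k => molT φ (t k) v x) Filter.atTop (nhds (v x)) := by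
  have h1 : v x = ∫ z, φ z • v x := by rw [integral_smul_const, hφ1, one_smul]
  rw [h1]
  simp_rw [fun k => molT_eq φ (ht k) v x]
  obtain ⟨C, hC⟩ := hv.bounded_above_of_compact_support hvc
  refine tendsto_integral_of_dominated_convergence (fun z => ‖φ z‖ * C) ?_ (hφi.norm.mul_const _) ?_ ?_
  · intro k
    exact hφi.aestronglyMeasurable.smul (by fun_prop : Continuous _).aestronglyMeasurable
  · intro k
    refine Filter.Eventually.of_forall fun z => ?_
    rw [norm_smul]; gcongr; exact hC _
  · refine Filter.Eventually.of_forall fun z => ?_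
    refine Filter.Tendsto.const_smul ?_ _
    have h2 : Filter.Tendsto (fun k => x - (t k)⁻¹ • z) Filter.atTop (nhds (x - (0:ℝ) • z)) :=
      tendsto_const_nhds.sub ((tendsto_inv_atTop_zero.comp htt).smul_const z)
    rw [zero_smul, sub_zero] at h2
    exact (hv.tendsto x).comp h2

lemma A1_expand (A1 : (Euc n →L[ℝ] V) →L[ℝ] W) (D : Euc n →L[ℝ] V) :
    A1 D = ∑ i, symL A1 (EuclideanSpace.basisFun (Fin n) ℝ i)
      (D (EuclideanSpace.basisFun (Fin n) ℝ i)) := by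
  simp only [symL_apply]
  rw [← map_sum]
  congr 1
  ext y
  conv_lhs => rw [← (EuclideanSpace.basisFun (Fin n) ℝ).sum_repr' y, map_sum]
  rw [_root_.sum_apply]
  refine Finset.sum_congr rfl fun i _ => ?_
  rw [map_smul]; rfl

lemma molT_step (A1 : (Euc n →L[ℝ] V) →L[ℝ] W) (G : Euc n → (W →L[ℝ] V)) (φ : Euc n → ℝ)
    (hG : ContDiff ℝ 1 G) (hφ : Continuous φ)
    (hGφ : ∀ x v, ∑ i, (fderiv ℝ G x (EuclideanSpace.basisFun (Fin n) ℝ i))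
        (symL A1 (EuclideanSpace.basisFun (Fin n) ℝ i) v) = (2 ^ n * φ ((2:ℝ) • x) - φ x) • v)
    (v : Euc n → V) (hv : ContDiff ℝ 1 v) (hvc : HasCompactSupport v) {t : ℝ} (ht : 0 < t)
    (x : Euc n) :
    molT φ (2 * t) v x - molT φ t v x
      = ∫ y, (t ^ n * t⁻¹) • (G (t • (x - y)) (A1 (fderiv ℝ v y))) := by
  have hvcont := hv.continuous
  have hv' : Continuous (fderiv ℝ v) := hv.continuous_fderiv (by norm_num)
  have hG' : Continuous (fderiv ℝ G) := hG.continuous_fderiv (by norm_num)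
  have hGc := hG.continuous
  have hvc' : HasCompactSupport (fderiv ℝ v) := hvc.fderiv ℝ
  set e := EuclideanSpace.basisFun (Fin n) ℝ with he
  have parts : ∀ i, ∫ y, G (t • (x - y)) (symL A1 (e i) (fderiv ℝ v y (e i)))
      = t • ∫ y, (fderiv ℝ G (t • (x - y)) (e i)) (symL A1 (e i) (v y)) := by
    intro i
    have hH : ∀ y, HasFDerivAt (fun y => G (t • (x - y)))
        ((fderiv ℝ G (t • (x - y))).comp (t • (-ContinuousLinearMap.id ℝ (Euc n)))) y := by
      intro y
      have h1 : HasFDerivAt (fun y : Euc n => t • (x - y))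
          (t • (-ContinuousLinearMap.id ℝ (Euc n))) y :=
        ((hasFDerivAt_id y).const_sub x).const_smul t
      exact ((hG.differentiable (by norm_num)) (t • (x - y))).hasFDerivAt.comp y h1
    have hg : ∀ y, HasFDerivAt (fun y => symL A1 (e i) (v y))
        ((symL A1 (e i)).comp (fderiv ℝ v y)) y := fun y =>
      (symL A1 (e i)).hasFDerivAt.comp y ((hv.differentiable (by norm_num)) y).hasFDerivAt
    have := integral_bilinear_hasFDerivAt_right_eq_neg_left_of_integrable
      (μ := (volume : Measure (Euc n))) (v := e i)
      (B := ContinuousLinearMap.id ℝ (W →L[ℝ] V))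
      (f := fun y => G (t • (x - y))) (g := fun y => symL A1 (e i) (v y))
      (f' := fun y => (fderiv ℝ G (t • (x - y))).comp (t • (-ContinuousLinearMap.id ℝ (Euc n))))
      (g' := fun y => (symL A1 (e i)).comp (fderiv ℝ v y)) ?_ ?_ ?_
      (fun y _ => hH y) (fun y _ => hg y)
    · simp only [ContinuousLinearMap.id_apply, ContinuousLinearMap.comp_apply,
        _root_.smul_apply, _root_.neg_apply] at this
      rw [this, ← integral_neg, ← integral_smul]
      congr 1; ext y
      simp
    · refine Continuous.integrable_of_hasCompactSupport ?_ ?_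
      · simp only [ContinuousLinearMap.id_apply, ContinuousLinearMap.comp_apply]
        fun_prop
      · refine hvc.mono fun y hy => ?_
        contrapose! hy
        simp only [Function.mem_support, not_not] at hy ⊢
        simp [hy]
    · refine Continuous.integrable_of_hasCompactSupport ?_ ?_
      · simp only [ContinuousLinearMap.id_apply, ContinuousLinearMap.comp_apply]
        fun_prop
      · refine hvc'.mono fun y hy => ?_
        contrapose! hy
        simp only [Function.mem_support, not_not] at hy ⊢
        simp [hy]
    · refine Continuous.integrable_of_hasCompactSupport ?_ ?_
      · simp only [ContinuousLinearMap.id_apply]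
        fun_prop
      · refine hvc.mono fun y hy => ?_
        contrapose! hy
        simp only [Function.mem_support, not_not] at hy ⊢
        simp [hy]
  have int1 : ∀ i, Integrable (fun y => G (t • (x - y)) (symL A1 (e i) (fderiv ℝ v y (e i)))) := by
    intro i
    refine Continuous.integrable_of_hasCompactSupport (by fun_prop) (hvc'.mono fun y hy => ?_)
    contrapose! hy
    simp only [Function.mem_support, not_not] at hy ⊢
    simp [hy]
  have int2 : ∀ i, Integrable (fun y => (fderiv ℝ G (t • (x - y)) (e i)) (symL A1 (e i) (v y))) := by
    intro i
    refine Continuous.integrable_of_hasCompactSupport (by fun_prop) (hvc.mono fun y hy => ?_)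
    contrapose! hy
    simp only [Function.mem_support, not_not] at hy ⊢
    simp [hy]
  have e1 : (∫ y, G (t • (x - y)) (A1 (fderiv ℝ v y)))
      = t • ∫ y, (2 ^ n * φ ((2:ℝ) • (t • (x - y))) - φ (t • (x - y))) • v y := by
    calc _ = ∫ y, ∑ i, G (t • (x - y)) (symL A1 (e i) (fderiv ℝ v y (e i))) := by
          congr 1; ext y
          rw [A1_expand, map_sum]
      _ = ∑ i, t • ∫ y, (fderiv ℝ G (t • (x - y)) (e i)) (symL A1 (e i) (v y)) := by
          rw [integral_finsetSum _ fun i _ => int1 i]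
          exact Finset.sum_congr rfl fun i _ => parts i
      _ = t • ∫ y, ∑ i, (fderiv ℝ G (t • (x - y)) (e i)) (symL A1 (e i) (v y)) := by
          rw [integral_finsetSum _ fun i _ => int2 i, Finset.smul_sum]
      _ = _ := by
          congr 2; ext y
          exact hGφ _ _
  rw [integral_smul, e1, smul_smul, mul_assoc, inv_mul_cancel₀ ht.ne', mul_one, ← integral_smul,
    molT, molT, ← integral_sub (molT_integrable φ hφ _ v hvcont hvc x)
    (molT_integrable φ hφ t v hvcont hvc x)]
  congr 1; ext y
  rw [← sub_smul, smul_smul, mul_smul (2:ℝ) t (x - y)]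
  congr 1
  ring

lemma molT_step_le (A1 : (Euc n →L[ℝ] V) →L[ℝ] W) (G : Euc n → (W →L[ℝ] V)) (φ : Euc n → ℝ)
    (hG : ContDiff ℝ 1 G) (hGi : Integrable G) (hφ : Continuous φ)
    (hGφ : ∀ x v, ∑ i, (fderiv ℝ G x (EuclideanSpace.basisFun (Fin n) ℝ i))
        (symL A1 (EuclideanSpace.basisFun (Fin n) ℝ i) v) = (2 ^ n * φ ((2:ℝ) • x) - φ x) • v)
    (v : Euc n → V) (hv : ContDiff ℝ 1 v) (hvc : HasCompactSupport v) {t : ℝ} (ht : 0 < t) :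
    ∫⁻ x, ‖molT φ (2 * t) v x - molT φ t v x‖ₑ
      ≤ ENNReal.ofReal (t⁻¹ * ((∫ x, ‖G x‖) * ∫ y, ‖A1 (fderiv ℝ v y)‖)) := by
  have hv' : Continuous (fderiv ℝ v) := hv.continuous_fderiv (by norm_num)
  have hGc := hG.continuous
  have hvc' : HasCompactSupport (fderiv ℝ v) := hvc.fderiv ℝ
  have hAi : Integrable (fun y => A1 (fderiv ℝ v y)) :=
    Continuous.integrable_of_hasCompactSupport (by fun_prop) (hvc'.comp_left (map_zero A1))
  have hs : ∀ y, ∫⁻ x, ‖G (t • (x - y))‖ₑ = ENNReal.ofReal ((t ^ n)⁻¹ * ∫ x, ‖G x‖) := by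
    intro y
    rw [lintegral_sub_right_eq_self (fun x => ‖G (t • x)‖ₑ) y]
    rw [← ofReal_integral_norm_eq_lintegral_enorm (hGi.comp_smul ht.ne')]
    congr 1
    rw [Measure.integral_comp_smul volume (fun x => ‖G x‖)]
    simp only [finrank_euclideanSpace, Fintype.card_fin]
    rw [abs_of_pos (by positivity), smul_eq_mul]
  calc _ ≤ ∫⁻ x, ∫⁻ y, ENNReal.ofReal (t ^ n * t⁻¹) * (‖G (t • (x - y))‖ₑ * ‖A1 (fderiv ℝ v y)‖ₑ) := by
        refine lintegral_mono fun x => ?_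
        rw [molT_step A1 G φ hG hφ hGφ v hv hvc ht]
        refine (enorm_integral_le_lintegral_enorm _).trans (lintegral_mono fun y => ?_)
        rw [enorm_smul, Real.enorm_of_nonneg (by positivity)]
        gcongr
        exact ContinuousLinearMap.le_opENorm _ _
    _ = ∫⁻ y, ∫⁻ x, ENNReal.ofReal (t ^ n * t⁻¹) * (‖G (t • (x - y))‖ₑ * ‖A1 (fderiv ℝ v y)‖ₑ) := by
        refine lintegral_lintegral_swap (Measurable.aemeasurable ?_)
        have m1 : Measurable fun p : Euc n × Euc n => ‖G (t • (p.1 - p.2))‖ₑ :=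
          (by fun_prop : Continuous _).measurable
        have m2 : Measurable fun p : Euc n × Euc n => ‖A1 (fderiv ℝ v p.2)‖ₑ :=
          (by fun_prop : Continuous _).measurable
        exact (m1.mul m2).const_mul _
    _ = ∫⁻ y, ENNReal.ofReal (t ^ n * t⁻¹) * (ENNReal.ofReal ((t ^ n)⁻¹ * ∫ x, ‖G x‖) * ‖A1 (fderiv ℝ v y)‖ₑ) := by
        refine lintegral_congr fun y => ?_
        rw [lintegral_const_mul', lintegral_mul_const', hs]
        · exact enorm_ne_top
        · exact ENNReal.ofReal_ne_top
    _ = _ := by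
        rw [lintegral_const_mul' _ _ ENNReal.ofReal_ne_top,
          lintegral_const_mul' _ _ ENNReal.ofReal_ne_top,
          ← ofReal_integral_norm_eq_lintegral_enorm hAi, ← ENNReal.ofReal_mul, ← ENNReal.ofReal_mul]
        · congr 1
          field_simp
        · positivity
        · have : 0 ≤ ∫ x, ‖G x‖ := integral_nonneg fun _ => norm_nonneg _
          positivity

lemma molT_le (A1 : (Euc n →L[ℝ] V) →L[ℝ] W) (G : Euc n → (W →L[ℝ] V)) (φ : Euc n → ℝ)
    (hG : ContDiff ℝ 1 G) (hGi : Integrable G) (hφ : Continuous φ) (hφi : Integrable φ)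
    (hφ1 : ∫ x, φ x = 1) {L : ℝ} (hL0 : 0 ≤ L) (hL : ∀ x y, |φ x - φ y| ≤ L * ‖x - y‖)
    (hGφ : ∀ x v, ∑ i, (fderiv ℝ G x (EuclideanSpace.basisFun (Fin n) ℝ i))
        (symL A1 (EuclideanSpace.basisFun (Fin n) ℝ i) v) = (2 ^ n * φ ((2:ℝ) • x) - φ x) • v)
    (v : Euc n → V) (hv : ContDiff ℝ 1 v) (hvc : HasCompactSupport v) (J : ℕ) :
    ∫⁻ x, ‖v x - molT φ (2 ^ J) v x‖ₑ
      ≤ ENNReal.ofReal (2 * (2 ^ J)⁻¹ * ((∫ x, ‖G x‖) * ∫ y, ‖A1 (fderiv ℝ v y)‖)) := by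
  set K := ((∫ x, ‖G x‖) * ∫ y, ‖A1 (fderiv ℝ v y)‖) with hK
  have hK0 : 0 ≤ K := mul_nonneg (integral_nonneg fun _ => norm_nonneg _)
    (integral_nonneg fun _ => norm_nonneg _)
  have hcont : ∀ k : ℕ, Continuous (molT φ (2 ^ k) v) := fun k =>
    molT_cont φ hφ hL0 hL (by positivity) v hv.continuous hvc
  have hk : ∀ k : ℕ, ∫⁻ x, ‖molT φ (2 ^ (J + k)) v x - molT φ (2 ^ J) v x‖ₑ
      ≤ ENNReal.ofReal ((2 * (2 ^ J)⁻¹ - 2 * (2 ^ (J + k))⁻¹) * K) := by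
    intro k
    induction k with
    | zero => simp
    | succ k ih =>
      have h1 := molT_step_le A1 G φ hG hGi hφ hGφ v hv hvc (t := 2 ^ (J + k)) (by positivity)
      rw [← hK, ← pow_succ'] at h1
      calc _ ≤ ∫⁻ x, (‖molT φ (2 ^ (J + k + 1)) v x - molT φ (2 ^ (J + k)) v x‖ₑ
              + ‖molT φ (2 ^ (J + k)) v x - molT φ (2 ^ J) v x‖ₑ) := by
            refine lintegral_mono fun x => ?_
            refine le_trans (le_of_eq ?_) (enorm_add_le _ _)
            rw [sub_add_sub_cancel]; rfl
        _ = _ := lintegral_add_left (((hcont _).sub (hcont _)).enorm.measurable) _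
        _ ≤ _ := add_le_add h1 ih
        _ = _ := by
            rw [← ENNReal.ofReal_add (by positivity)]
            · congr 1
              rw [← add_assoc J k 1, pow_succ]
              field_simp
              ring
            · refine mul_nonneg ?_ hK0
              rw [← mul_sub]
              refine mul_nonneg (by norm_num) (sub_nonneg.2 ?_)
              exact inv_anti₀ (by positivity) (pow_le_pow_right₀ (by norm_num) (by omega))
  have hlim : ∀ x, Filter.Tendsto (fun k => ‖molT φ (2 ^ (J + k)) v x - molT φ (2 ^ J) v x‖ₑ)
      Filter.atTop (nhds ‖v x - molT φ (2 ^ J) v x‖ₑ) := by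
    intro x
    refine Filter.Tendsto.enorm (Filter.Tendsto.sub ?_ tendsto_const_nhds)
    refine molT_tendsto φ hφi hφ1 v hv.continuous hvc x (fun k => 2 ^ (J + k)) (fun k => by positivity) ?_
    exact (tendsto_pow_atTop_atTop_of_one_lt (by norm_num)).comp
      (Filter.tendsto_atTop_mono (fun k => Nat.le_add_left k J) Filter.tendsto_id)
  calc _ = ∫⁻ x, Filter.liminf (fun k => ‖molT φ (2 ^ (J + k)) v x - molT φ (2 ^ J) v x‖ₑ) Filter.atTop :=
        lintegral_congr fun x => (hlim x).liminf_eq.symm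
    _ ≤ Filter.liminf (fun k => ∫⁻ x, ‖molT φ (2 ^ (J + k)) v x - molT φ (2 ^ J) v x‖ₑ) Filter.atTop :=
        lintegral_liminf_le fun k => ((hcont _).sub (hcont _)).enorm.measurable
    _ ≤ _ := by
        refine Filter.liminf_le_of_le (by isBoundedDefault) fun b hb => ?_
        obtain ⟨k, hkb⟩ := hb.exists
        refine hkb.trans ((hk k).trans (ENNReal.ofReal_le_ofReal ?_))
        refine mul_le_mul_of_nonneg_right ?_ hK0
        have : (0:ℝ) ≤ 2 * (2 ^ (J + k))⁻¹ := by positivity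
        linarith
end Mollify

section Ball

lemma exists_A1 (A : OpCoeff n 1 V W) : ∃ A1 : (Euc n →L[ℝ] V) →L[ℝ] W,
    ∀ u x, opApply A u x = A1 (fderiv ℝ u x) := by
  refine ⟨A.comp ((continuousMultilinearCurryFin1 ℝ (Euc n) V).symm :
    (Euc n →L[ℝ] V) →L[ℝ] _), fun u x => ?_⟩
  rw [opApply]
  simp only [ContinuousLinearMap.comp_apply]
  congr 1
  ext m
  rw [iteratedFDeriv_one_apply]
  exact (continuousMultilinearCurryFin1_symm_apply _ _).symm

lemma intB {F : Type*} [NormedAddCommGroup F] {f : Euc n → F}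
    (hf : ContinuousOn f (closedBall 0 1)) : IntegrableOn f (ball 0 1) :=
  (hf.integrableOn_compact (isCompact_closedBall _ _)).mono_set ball_subset_closedBall

lemma cdAt {u : Euc n → V} (hu : ContDiffOn ℝ (⊤ : ℕ∞) u (closedBall 0 1)) {x : Euc n}
    (hx : x ∈ ball (0 : Euc n) 1) : ContDiffAt ℝ (⊤ : ℕ∞) u x :=
  hu.contDiffAt (Filter.mem_of_superset (isOpen_ball.mem_nhds hx) ball_subset_closedBall)

lemma intD {u : Euc n → V} (hu : ContDiffOn ℝ (⊤ : ℕ∞) u (closedBall 0 1)) :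
    IntegrableOn (fderiv ℝ u) (ball 0 1) := by
  have hU : UniqueDiffOn ℝ (closedBall (0 : Euc n) 1) :=
    uniqueDiffOn_convex (convex_closedBall _ _)
      ⟨0, ball_subset_interior_closedBall (mem_ball_self one_pos)⟩
  have h1 := intB (hu.continuousOn_fderivWithin hU (by simp))
  refine h1.congr_fun (fun x hx => ?_) measurableSet_ball
  exact fderivWithin_of_mem_nhds
    (Filter.mem_of_superset (isOpen_ball.mem_nhds hx) ball_subset_closedBall)

/-- The `W^{𝔸,1}` norm on the ball. -/
def nrmB (A1 : (Euc n →L[ℝ] V) →L[ℝ] W) (u : Euc n → V) : ℝ :=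
  (∫ x in ball (0 : Euc n) 1, ‖u x‖) + ∫ x in ball (0 : Euc n) 1, ‖A1 (fderiv ℝ u x)‖

/-- The embedding hypothesis. -/
def Emb (A1 : (Euc n →L[ℝ] V) →L[ℝ] W) (c : ℝ) : Prop :=
  ∀ u : Euc n → V, ContDiffOn ℝ (⊤ : ℕ∞) u (closedBall 0 1) →
      (∫ x in ball (0 : Euc n) 1, ‖u x‖ ^ ((n : ℝ) / (n - 1))) ^ (((n : ℝ) - 1) / n)
        ≤ c * nrmB A1 u

lemma nrmB_sub (A1 : (Euc n →L[ℝ] V) →L[ℝ] W) {u u' : Euc n → V}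
    (hu : ContDiffOn ℝ (⊤ : ℕ∞) u (closedBall 0 1))
    (hu' : ContDiffOn ℝ (⊤ : ℕ∞) u' (closedBall 0 1)) :
    nrmB A1 (fun x => u x - u' x) ≤ nrmB A1 u + nrmB A1 u' := by
  have i1 := intB hu.continuousOn
  have i2 := intB hu'.continuousOn
  have j1 := A1.integrable_comp (intD hu)
  have j2 := A1.integrable_comp (intD hu')
  have h1 : ∫ x in ball (0 : Euc n) 1, ‖u x - u' x‖ ≤
      (∫ x in ball (0 : Euc n) 1, ‖u x‖) + ∫ x in ball (0 : Euc n) 1, ‖u' x‖ := by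
    rw [← integral_add i1.norm i2.norm]
    exact integral_mono (i1.sub i2).norm (i1.norm.add i2.norm) fun x => norm_sub_le _ _
  have h2 : ∫ x in ball (0 : Euc n) 1, ‖A1 (fderiv ℝ (fun x => u x - u' x) x)‖ ≤
      (∫ x in ball (0 : Euc n) 1, ‖A1 (fderiv ℝ u x)‖)
        + ∫ x in ball (0 : Euc n) 1, ‖A1 (fderiv ℝ u' x)‖ := by
    rw [← integral_add j1.norm j2.norm]
    have e : ∀ x ∈ ball (0 : Euc n) 1, ‖A1 (fderiv ℝ (fun x => u x - u' x) x)‖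
        = ‖A1 (fderiv ℝ u x) - A1 (fderiv ℝ u' x)‖ := by
      intro x hx
      rw [fderiv_fun_sub ((cdAt hu hx).differentiableAt (by simp))
        ((cdAt hu' hx).differentiableAt (by simp)), map_sub]
    rw [setIntegral_congr_fun measurableSet_ball e]
    exact integral_mono (j1.sub j2).norm (j1.norm.add j2.norm) fun x => norm_sub_le _ _
  unfold nrmB
  linarith

lemma one_lt_p (hn : 1 < n) : 1 < (n : ℝ) / (n - 1) := by
  have : (1:ℝ) < n := by exact_mod_cast hn
  rw [lt_div_iff₀ (by linarith)]; linarith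

lemma bound_p (hn : 1 < n) {A1 : (Euc n →L[ℝ] V) →L[ℝ] W} {c : ℝ} (hc : 0 < c) (hE : Emb A1 c)
    {u : Euc n → V} (hu : ContDiffOn ℝ (⊤ : ℕ∞) u (closedBall 0 1)) (hN : nrmB A1 u ≤ 2) :
    ∫ x in ball (0 : Euc n) 1, ‖u x‖ ^ ((n : ℝ) / (n - 1)) ≤ (c * 2) ^ ((n : ℝ) / (n - 1)) := by
  have hn' : (1:ℝ) < n := by exact_mod_cast hn
  have hI : 0 ≤ ∫ x in ball (0 : Euc n) 1, ‖u x‖ ^ ((n : ℝ) / (n - 1)) :=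
    integral_nonneg fun x => by positivity
  have h1 := (hE u hu).trans (mul_le_mul_of_nonneg_left hN hc.le)
  have h2 := Real.rpow_le_rpow (by positivity) h1 (zero_le_one.trans (one_lt_p hn).le)
  rw [← Real.rpow_mul hI] at h2
  have : ((n:ℝ) - 1) / n * (n / (n - 1)) = 1 := by
    have : (n:ℝ) - 1 ≠ 0 := by linarith
    field_simp
  rwa [this, Real.rpow_one] at h2

lemma intP {u : Euc n → V} (hu : ContDiffOn ℝ (⊤ : ℕ∞) u (closedBall 0 1)) {q : ℝ}
    (hq : 0 ≤ q) : IntegrableOn (fun x => ‖u x‖ ^ q) (ball (0 : Euc n) 1) :=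
  intB (hu.continuousOn.norm.rpow_const fun _ _ => Or.inr hq)

lemma pw1 {a R p : ℝ} (ha : 0 ≤ a) (hR : 0 < R) (hp : 1 < p) : a ≤ R + R ^ (1 - p) * a ^ p := by
  rcases le_total a R with h | h
  · have : 0 ≤ R ^ (1 - p) * a ^ p := by positivity
    linarith
  · have ha' : 0 < a := hR.trans_le h
    have h1 : a ^ (1 - p) ≤ R ^ (1 - p) := Real.rpow_le_rpow_of_nonpos hR h (by linarith)
    calc a = a ^ (1 - p) * a ^ p := by rw [← Real.rpow_add ha']; simp
      _ ≤ R ^ (1 - p) * a ^ p := by gcongr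
      _ ≤ _ := by linarith

lemma pw2 {a R p q : ℝ} (ha : 0 ≤ a) (hR : 0 < R) (hq : 1 ≤ q) (hqp : q < p) :
    a ^ q ≤ R ^ (q - 1) * a + R ^ (q - p) * a ^ p := by
  rcases ha.eq_or_lt with h0 | ha'
  · rw [← h0, Real.zero_rpow (by linarith), Real.zero_rpow (by linarith)]; simp
  rcases le_total a R with h | h
  · have h1 : a ^ (q - 1) ≤ R ^ (q - 1) := Real.rpow_le_rpow ha h (by linarith)
    have : 0 ≤ R ^ (q - p) * a ^ p := by positivity
    calc a ^ q = a ^ (q - 1) * a := by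
          conv_rhs => rw [← Real.rpow_one a]
          rw [← Real.rpow_mul ha, one_mul, ← Real.rpow_add ha']; simp
      _ ≤ R ^ (q - 1) * a := by gcongr
      _ ≤ _ := by linarith
  · have h1 : a ^ (q - p) ≤ R ^ (q - p) := Real.rpow_le_rpow_of_nonpos hR h (by linarith)
    have : 0 ≤ R ^ (q - 1) * a := by positivity
    calc a ^ q = a ^ (q - p) * a ^ p := by rw [← Real.rpow_add ha']; simp
      _ ≤ R ^ (q - p) * a ^ p := by gcongr
      _ ≤ _ := by linarith

lemma exists_R {s K ε : ℝ} (hs : 0 < s) (hε : 0 < ε) :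
    ∃ R : ℝ, 0 < R ∧ R ^ (-s) * K ≤ ε := by
  have h1 : Filter.Tendsto (fun R : ℝ => R ^ (-s) * K) Filter.atTop (nhds (0 * K)) :=
    (tendsto_rpow_neg_atTop hs).mul_const K
  rw [zero_mul] at h1
  obtain ⟨R, hR⟩ := ((h1.eventually (ge_mem_nhds hε)).and (Filter.eventually_gt_atTop 0)).exists
  exact ⟨R, hR.2, hR.1⟩

lemma equi (hn : 1 < n) {A1 : (Euc n →L[ℝ] V) →L[ℝ] W} {c : ℝ} (hc : 0 < c) (hE : Emb A1 c)
    {ε : ℝ} (hε : 0 < ε) : ∃ δ : ℝ, 0 < δ ∧ ∀ u : Euc n → V,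
      ContDiffOn ℝ (⊤ : ℕ∞) u (closedBall 0 1) → nrmB A1 u ≤ 2 → ∀ S ⊆ ball (0 : Euc n) 1,
      MeasurableSet S → volume.real S ≤ δ → ∫ x in S, ‖u x‖ ≤ ε := by
  have hp := one_lt_p hn
  set p := (n : ℝ) / (n - 1) with hpdef
  obtain ⟨R, hR, hRε⟩ := exists_R (s := p - 1) (K := (c * 2) ^ p) (sub_pos.2 hp) (half_pos hε)
  refine ⟨ε / 2 / R, by positivity, fun u hu hN S hSB hS hvol => ?_⟩
  have hb := bound_p hn hc hE hu hN
  rw [← hpdef] at hb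
  have hip : IntegrableOn (fun x => ‖u x‖ ^ p) (ball (0 : Euc n) 1) := intP hu (by linarith)
  have hfin : volume S ≠ ⊤ := (measure_mono_top hSB).mt measure_ball_lt_top.ne
  have hiS : IntegrableOn (fun x => R ^ (1 - p) * ‖u x‖ ^ p) S := (hip.mono_set hSB).const_mul _
  have hcS : Integrable (fun _ : Euc n => R) (volume.restrict S) := integrableOn_const hfin
  have hiS2 : Integrable (fun x => R ^ (1 - p) * ‖u x‖ ^ p) (volume.restrict S) := hiS
  calc ∫ x in S, ‖u x‖ ≤ ∫ x in S, (R + R ^ (1 - p) * ‖u x‖ ^ p) := by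
        refine integral_mono ((intB hu.continuousOn).mono_set hSB).norm
          (hcS.add hiS2) fun x => pw1 (norm_nonneg _) hR hp
    _ = volume.real S * R + R ^ (1 - p) * ∫ x in S, ‖u x‖ ^ p := by
        rw [integral_add hcS hiS2, integral_const_mul, setIntegral_const, smul_eq_mul]
    _ ≤ ε / 2 / R * R + R ^ (1 - p) * (c * 2) ^ p := by
        gcongr
        refine le_trans ?_ hb
        exact setIntegral_mono_set hip (Filter.Eventually.of_forall fun x => by positivity)
          (Filter.Eventually.of_forall hSB)
    _ ≤ _ := by
        rw [div_mul_cancel₀ _ hR.ne']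
        have : 1 - p = -(p - 1) := by ring
        rw [this]; linarith

lemma exists_small_vol (S : ℕ → Set (Euc n)) (hanti : Antitone S) (hm : ∀ k, MeasurableSet (S k))
    (hB : ∀ k, S k ⊆ ball 0 1) (h0 : volume (⋂ k, S k) = 0) {δ : ℝ} (hδ : 0 < δ) :
    ∃ k, volume.real (S k) ≤ δ := by
  have h1 := tendsto_measure_iInter_atTop (μ := (volume : Measure (Euc n)))
    (fun k => (hm k).nullMeasurableSet) hanti
    ⟨0, (measure_mono_top (hB 0)).mt measure_ball_lt_top.ne⟩
  rw [h0] at h1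
  obtain ⟨k, hk⟩ := (h1.eventually (ge_mem_nhds (ENNReal.ofReal_pos.2 hδ))).exists
  exact ⟨k, ENNReal.toReal_le_of_le_ofReal hδ.le hk⟩

lemma elliptic (hn : 1 < n) {A1 : (Euc n →L[ℝ] V) →L[ℝ] W} {c : ℝ} (hc : 0 < c) (hE : Emb A1 c)
    (ξ : Euc n) (hξ : ξ ≠ 0) (v : V) (hv : symL A1 ξ v = 0) : v = 0 := by
  by_contra hv0
  obtain ⟨δ, hδ, hequi⟩ := equi hn hc hE one_pos
  let S : ℕ → Set (Euc n) := fun k => ball 0 1 ∩ {x | |⟪ξ, x⟫| ≤ 1 / ((k : ℝ) + 1)}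
  have hcl : ∀ k, IsClosed {x : Euc n | |⟪ξ, x⟫| ≤ 1 / ((k : ℝ) + 1)} := fun k =>
    isClosed_le (by fun_prop) (by fun_prop)
  have hSm : ∀ k, MeasurableSet (S k) := fun k => measurableSet_ball.inter (hcl k).measurableSet
  have hSa : Antitone S := by
    intro k l hkl x hx
    exact ⟨hx.1, le_trans (show |⟪ξ, x⟫| ≤ _ from hx.2) (Nat.one_div_le_one_div hkl)⟩
  have hS0 : volume (⋂ k, S k) = 0 := by
    have hsub : (⋂ k, S k) ⊆ (LinearMap.ker ((innerSL ℝ ξ : Euc n →L[ℝ] ℝ) : Euc n →ₗ[ℝ] ℝ) : Set (Euc n)) := by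
      intro x hx
      rw [Set.mem_iInter] at hx
      have h1 : |⟪ξ, x⟫| ≤ 0 := ge_of_tendsto' tendsto_one_div_add_atTop_nhds_zero_nat
        fun k => (hx k).2
      simpa using h1
    refine measure_mono_null hsub (Measure.addHaar_submodule _ _ ?_)
    intro h
    have : ξ ∈ (LinearMap.ker ((innerSL ℝ ξ : Euc n →L[ℝ] ℝ) : Euc n →ₗ[ℝ] ℝ)) := by
      rw [h]; trivial
    simp at this
    exact hξ this
  obtain ⟨k, hk⟩ := exists_small_vol S hSa hSm (fun k => Set.inter_subset_left) hS0 hδ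
  have hk0 : (0:ℝ) < 1 / ((k : ℝ) + 1) := by positivity
  let f : ContDiffBump (0 : ℝ) := ⟨1 / ((k : ℝ) + 1) / 2, 1 / ((k : ℝ) + 1), by positivity, by linarith⟩
  let w : Euc n → V := fun x => f ⟪ξ, x⟫ • v
  have hf : ContDiff ℝ (⊤ : ℕ∞) f := f.contDiff
  have hin : ContDiff ℝ (⊤ : ℕ∞) (fun x : Euc n => (⟪ξ, x⟫ : ℝ)) := (innerSL ℝ ξ).contDiff
  have hw : ContDiff ℝ (⊤ : ℕ∞) w := (hf.comp hin).smul contDiff_const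
  have hdw : ∀ x, ∃ a : ℝ, fderiv ℝ w x = a • (innerSL ℝ ξ).smulRight v := by
    intro x
    have h1 : HasDerivAt f (deriv f ⟪ξ, x⟫) ⟪ξ, x⟫ :=
      ((hf.differentiable (by simp)) _).hasDerivAt
    have h2 : HasFDerivAt (fun x : Euc n => f ⟪ξ, x⟫) (deriv f ⟪ξ, x⟫ • (innerSL ℝ ξ)) x :=
      h1.comp_hasFDerivAt x (innerSL ℝ ξ).hasFDerivAt
    refine ⟨deriv f ⟪ξ, x⟫, ?_⟩
    have h3 : HasFDerivAt w _ x := h2.smul_const v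
    rw [h3.fderiv]
    ext y
    simp [smul_smul]
  set I := ∫ x in ball (0 : Euc n) 1, ‖w x‖ with hIdef
  have hwi : IntegrableOn w (ball 0 1) := intB hw.continuous.continuousOn
  have hI : 0 < I := by
    rw [hIdef, setIntegral_pos_iff_support_of_nonneg_ae
      (Filter.Eventually.of_forall fun x => norm_nonneg _) hwi.norm]
    have hop : IsOpen (Function.support (fun x => ‖w x‖) ∩ ball 0 1) :=
      (hw.continuous.norm.isOpen_support).inter isOpen_ball
    refine hop.measure_pos volume ⟨0, ?_, mem_ball_self one_pos⟩
    have : f 0 = 1 := f.one_of_mem_closedBall (mem_closedBall_self f.rIn_pos.le)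
    simp [w, this, hv0]
  let u : Euc n → V := fun x => (2 / I) • w x
  have hu : ContDiff ℝ (⊤ : ℕ∞) u := contDiff_const.smul hw
  have hnu : ∀ s : Set (Euc n), ∫ x in s, ‖u x‖ = 2 / I * ∫ x in s, ‖w x‖ := by
    intro s
    rw [← integral_const_mul]
    congr 1; ext x
    rw [norm_smul, Real.norm_of_nonneg (by positivity)]
  have hAu : ∀ x, A1 (fderiv ℝ u x) = 0 := by
    intro x
    obtain ⟨a, ha⟩ := hdw x
    have : fderiv ℝ u x = (2 / I) • fderiv ℝ w x :=
      fderiv_fun_const_smul ((hw.differentiable (by simp)) x) _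
    rw [this, ha, map_smul, map_smul, ← symL_apply, hv, smul_zero, smul_zero]
  have hN : nrmB A1 u = 2 := by
    unfold nrmB
    rw [hnu, ← hIdef]
    simp only [hAu, norm_zero, integral_zero, add_zero]
    field_simp
  have h1 := hequi u hu.contDiffOn hN.le (S k) Set.inter_subset_left (hSm k) hk
  have h2 : ∫ x in S k, ‖w x‖ = I := by
    rw [hIdef]
    refine (setIntegral_eq_of_subset_of_forall_sdiff_eq_zero measurableSet_ball Set.inter_subset_left ?_).symm
    rintro x ⟨hx1, hx2⟩
    have : f ⟪ξ, x⟫ = 0 := by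
      apply f.zero_of_le_dist
      have : ¬ |⟪ξ, x⟫| ≤ 1 / ((k : ℝ) + 1) := fun h => hx2 ⟨hx1, h⟩
      rw [Real.dist_eq, sub_zero]
      exact (not_le.1 this).le
    simp [w, this]
  rw [hnu, h2, div_mul_cancel₀ _ hI.ne'] at h1
  norm_num at h1

end Ball


section Core

lemma cutoff_props (A1 : (Euc n →L[ℝ] V) →L[ℝ] W) {ρ : Euc n → ℝ} (hρ : ContDiff ℝ 1 ρ)
    (hs : tsupport ρ ⊆ ball 0 1) (h0 : ∀ x, 0 ≤ ρ x) (h1 : ∀ x, ρ x ≤ 1) {K : ℝ}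
    (hK : ∀ x, ‖fderiv ℝ ρ x‖ ≤ K) {u : Euc n → V}
    (hu : ContDiffOn ℝ (⊤ : ℕ∞) u (closedBall 0 1)) :
    ContDiff ℝ 1 (fun x => ρ x • u x) ∧ HasCompactSupport (fun x => ρ x • u x) ∧
    ∫ x, ‖ρ x • u x‖ ≤ ∫ x in ball (0 : Euc n) 1, ‖u x‖ ∧
    ∫ x, ‖A1 (fderiv ℝ (fun x => ρ x • u x) x)‖ ≤
      (∫ x in ball (0 : Euc n) 1, ‖A1 (fderiv ℝ u x)‖)
        + ‖A1‖ * K * ∫ x in ball (0 : Euc n) 1, ‖u x‖ := by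
  have hts : tsupport (fun x => ρ x • u x) ⊆ tsupport ρ := tsupport_smul_subset_left ρ u
  have hcρ : HasCompactSupport ρ := (isCompact_closedBall (0 : Euc n) 1).of_isClosed_subset
    (isClosed_tsupport _) (hs.trans ball_subset_closedBall)
  have hv : ContDiff ℝ 1 (fun x => ρ x • u x) := by
    refine contDiff_iff_contDiffAt.2 fun x => ?_
    by_cases hx : x ∈ tsupport (fun x => ρ x • u x)
    swap
    · exact contDiffAt_const.congr_of_eventuallyEq (notMem_tsupport_iff_eventuallyEq.1 hx)
    exact hρ.contDiffAt.smul ((cdAt hu (hs (hts hx))).of_le (by exact_mod_cast le_top))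
  have hvc : HasCompactSupport (fun x => ρ x • u x) := hcρ.smul_right
  have iu := (intB hu.continuousOn).norm
  have iD := (A1.integrable_comp (intD hu)).norm
  have hz : ∀ x, x ∉ ball (0 : Euc n) 1 → x ∉ tsupport (fun x => ρ x • u x) :=
    fun x hx h => hx (hs (hts h))
  refine ⟨hv, hvc, ?_, ?_⟩
  · rw [← setIntegral_eq_integral_of_forall_compl_eq_zero (s := ball (0 : Euc n) 1)
      (fun x hx => by
        have : ρ x • u x = 0 :=
          image_eq_zero_of_notMem_tsupport (f := fun x => ρ x • u x) (hz x hx)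
        rw [this, norm_zero])]
    refine integral_mono (hv.continuous.integrable_of_hasCompactSupport hvc).norm.integrableOn
      iu fun x => ?_
    simp only [norm_smul, Real.norm_of_nonneg (h0 x)]
    exact mul_le_of_le_one_left (norm_nonneg _) (h1 x)
  · rw [← setIntegral_eq_integral_of_forall_compl_eq_zero (s := ball (0 : Euc n) 1)
      (fun x hx => by
        have h := fun hx' => hz x hx (support_fderiv_subset ℝ (f := fun x => ρ x • u x) hx')
        rw [Function.notMem_support.1 h, map_zero, norm_zero])]
    rw [← integral_const_mul, ← integral_add iD (iu.const_mul _)]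
    have hfi : Integrable (fun x => ‖A1 (fderiv ℝ (fun x => ρ x • u x) x)‖) :=
      (A1.integrable_comp ((hv.continuous_fderiv one_ne_zero).integrable_of_hasCompactSupport
        (hvc.fderiv ℝ))).norm
    refine setIntegral_mono_on hfi.integrableOn (iD.add (iu.const_mul _)) measurableSet_ball
      fun x hx => ?_
    have hd : fderiv ℝ (fun x => ρ x • u x) x = ρ x • fderiv ℝ u x
        + (fderiv ℝ ρ x).smulRight (u x) :=
      fderiv_fun_smul ((hρ.differentiable one_ne_zero) x)
        ((cdAt hu hx).differentiableAt (by simp))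
    rw [hd, map_add, map_smul]
    refine (norm_add_le _ _).trans (add_le_add ?_ ?_)
    · rw [norm_smul, Real.norm_of_nonneg (h0 x)]
      exact mul_le_of_le_one_left (norm_nonneg _) (h1 x)
    · refine (A1.le_opNorm _).trans ?_
      rw [ContinuousLinearMap.norm_smulRight_apply, mul_assoc]
      gcongr
      exact hK x

lemma exists_cutoff {r : ℝ} (hr0 : 0 < r) (hr1 : r < 1) : ∃ (ρ : Euc n → ℝ) (K : ℝ),
    ContDiff ℝ 1 ρ ∧ tsupport ρ ⊆ ball 0 1 ∧ (∀ x, 0 ≤ ρ x) ∧ (∀ x, ρ x ≤ 1) ∧ 0 ≤ K ∧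
    (∀ x, ‖fderiv ℝ ρ x‖ ≤ K) ∧ ∀ x ∈ closedBall (0 : Euc n) r, ρ x = 1 := by
  let f : ContDiffBump (0 : Euc n) := ⟨r, (r + 1) / 2, hr0, by linarith⟩
  have hf : ContDiff ℝ 1 f := f.contDiff
  have hc : HasCompactSupport f := f.hasCompactSupport
  obtain ⟨K, hK⟩ := (hf.continuous_fderiv one_ne_zero).bounded_above_of_compact_support
    (hc.fderiv ℝ)
  refine ⟨f, K, hf, ?_, fun x => f.nonneg, fun x => f.le_one, (norm_nonneg _).trans (hK 0), hK,
    fun x hx => f.one_of_mem_closedBall hx⟩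
  rw [f.tsupport_eq]
  exact closedBall_subset_ball (show (r + 1) / 2 < 1 by linarith)

lemma exists_layer {δ : ℝ} (hδ : 0 < δ) : ∃ r : ℝ, 0 < r ∧ r < 1 ∧
    volume.real (ball (0 : Euc n) 1 \ closedBall 0 r) ≤ δ := by
  have hA : Antitone (fun k : ℕ =>
      ball (0 : Euc n) 1 \ closedBall 0 (1 - 1 / ((k : ℝ) + 1 + 1))) := by
    intro k l hkl
    refine Set.sdiff_subset_sdiff_right (closedBall_subset_closedBall ?_)
    gcongr
  have hZ : volume (⋂ k : ℕ,
      ball (0 : Euc n) 1 \ closedBall 0 (1 - 1 / ((k : ℝ) + 1 + 1))) = 0 := by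
    refine measure_mono_null (t := ∅) (fun x hx => ?_) measure_empty
    rw [Set.mem_iInter] at hx
    have h1 : ∀ k : ℕ, 1 - ‖x‖ ≤ 1 / ((k : ℝ) + 1) := by
      intro k
      have := (hx k).2
      rw [mem_closedBall_zero_iff, not_le] at this
      have h2 : 1 / ((k : ℝ) + 1 + 1) ≤ 1 / ((k : ℝ) + 1) := by gcongr; linarith
      linarith
    have h2 : 1 - ‖x‖ ≤ 0 := ge_of_tendsto' tendsto_one_div_add_atTop_nhds_zero_nat h1
    have h3 := (hx 0).1
    rw [mem_ball_zero_iff] at h3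
    linarith
  obtain ⟨k, hk⟩ := exists_small_vol _ hA
    (fun k => measurableSet_ball.diff measurableSet_closedBall) (fun k => Set.sdiff_subset)
    hZ hδ
  refine ⟨_, ?_, ?_, hk⟩
  · rw [sub_pos, div_lt_one (by positivity)]
    have : (0:ℝ) ≤ k := k.cast_nonneg
    linarith
  · have : 0 < 1 / ((k : ℝ) + 1 + 1) := by positivity
    linarith

lemma core (hn : 1 < n) {A1 : (Euc n →L[ℝ] V) →L[ℝ] W} {c : ℝ} (hc : 0 < c) (hE : Emb A1 c)
    {ε : ℝ} (hε : 0 < ε) : ∃ (t : Finset (Euc n)) (F : (Euc n → V) → (t → V)) (C η : ℝ), 0 < η ∧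
      (∀ u u' : Euc n → V, ContDiffOn ℝ (⊤ : ℕ∞) u (closedBall 0 1) →
        ContDiffOn ℝ (⊤ : ℕ∞) u' (closedBall 0 1) → F (fun x => u x - u' x) = F u - F u') ∧
      (∀ u : Euc n → V, ContDiffOn ℝ (⊤ : ℕ∞) u (closedBall 0 1) → nrmB A1 u ≤ 2 →
        ‖F u‖ ≤ C) ∧
      (∀ z : Euc n → V, ContDiffOn ℝ (⊤ : ℕ∞) z (closedBall 0 1) → nrmB A1 z ≤ 2 →
        ‖F z‖ ≤ η → ∫ x in ball (0 : Euc n) 1, ‖z x‖ ≤ ε) := by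
  obtain ⟨G, φ, hG, hGi, hφ, hφi, hφ1, ⟨Cφ, hC0, hC⟩, ⟨L, hL0, hL⟩, hGφ⟩ :=
    kernel_exists A1 (fun ξ hξ v hv => elliptic hn hc hE ξ hξ v hv)
  have hε3 : 0 < ε / 3 := by positivity
  obtain ⟨δ, hδ, hequi⟩ := equi hn hc hE hε3
  obtain ⟨r, hr0, hr1, hr⟩ := exists_layer (n := n) hδ
  obtain ⟨ρ, K, hρ, hs, h0, h1, hK0, hK, hρ1⟩ := exists_cutoff (n := n) hr0 hr1
  set M : ℝ := (∫ x, ‖G x‖) * (2 + ‖A1‖ * K * 2) with hM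
  have hG0 : 0 ≤ ∫ x, ‖G x‖ := integral_nonneg fun _ => norm_nonneg _
  have hM0 : 0 ≤ M := by positivity
  -- choice of the mollification scale
  obtain ⟨J, hJ⟩ : ∃ J : ℕ, 2 * ((2:ℝ) ^ J)⁻¹ * M ≤ ε / 3 := by
    have h2 : Filter.Tendsto (fun J : ℕ => 2 * ((2:ℝ) ^ J)⁻¹ * M) Filter.atTop
        (nhds (2 * 0 * M)) :=
      ((tendsto_inv_atTop_zero.comp
        (tendsto_pow_atTop_atTop_of_one_lt (one_lt_two))).const_mul 2).mul_const M
    rw [mul_zero, zero_mul] at h2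
    exact (h2.eventually (ge_mem_nhds hε3)).exists
  have ht : (0:ℝ) < 2 ^ J := by positivity
  set T : ℝ := 2 ^ J with hT
  set vB : ℝ := volume.real (ball (0 : Euc n) 1) with hvB
  have hvB0 : 0 ≤ vB := measureReal_nonneg
  set Λ : ℝ := T ^ n * (L * T) * 2 with hΛ
  have hΛ0 : 0 ≤ Λ := by positivity
  set η : ℝ := ε / 3 / 2 / (vB + 1) with hη
  have hη0 : 0 < η := by positivity
  set s : ℝ := η / (Λ + 1) with hsdef
  have hs0 : 0 < s := by positivity
  obtain ⟨t0, -, htfin, hcov⟩ :=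
    (isCompact_closedBall (0 : Euc n) 1).finite_cover_balls hs0
  let t : Finset (Euc n) := htfin.toFinset
  let F : (Euc n → V) → (t → V) := fun z i => molT φ T (fun x => ρ x • z x) i
  have hNu : ∀ z : Euc n → V, nrmB A1 z ≤ 2 → ∫ x in ball (0 : Euc n) 1, ‖z x‖ ≤ 2 ∧
      ∫ x in ball (0 : Euc n) 1, ‖A1 (fderiv ℝ z x)‖ ≤ 2 := by
    intro z hz
    have e1 : 0 ≤ ∫ x in ball (0 : Euc n) 1, ‖z x‖ := integral_nonneg fun _ => norm_nonneg _
    have e2 : 0 ≤ ∫ x in ball (0 : Euc n) 1, ‖A1 (fderiv ℝ z x)‖ :=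
      integral_nonneg fun _ => norm_nonneg _
    unfold nrmB at hz
    constructor <;> linarith
  refine ⟨t, F, T ^ n * Cφ * 2, η, hη0, ?_, ?_, ?_⟩
  · intro u u' hu hu'
    obtain ⟨a1, a2, -⟩ := cutoff_props A1 hρ hs h0 h1 hK hu
    obtain ⟨b1, b2, -⟩ := cutoff_props A1 hρ hs h0 h1 hK hu'
    funext i
    simp only [F, Pi.sub_apply, molT]
    rw [← integral_sub (molT_integrable φ hφ T _ a1.continuous a2 i)
      (molT_integrable φ hφ T _ b1.continuous b2 i)]
    congr 1; ext y
    simp only [smul_sub]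
  · intro u hu hN
    obtain ⟨a1, a2, a3, -⟩ := cutoff_props A1 hρ hs h0 h1 hK hu
    rw [pi_norm_le_iff_of_nonneg (by positivity)]
    intro i
    refine (molT_bdd φ hC ht _ (a1.continuous.integrable_of_hasCompactSupport a2) i).trans ?_
    gcongr
    exact a3.trans (hNu u hN).1
  · intro z hz hN hF
    obtain ⟨a1, a2, a3, a4⟩ := cutoff_props A1 hρ hs h0 h1 hK hz
    obtain ⟨n1, n2⟩ := hNu z hN
    set v : Euc n → V := fun x => ρ x • z x with hv
    have hvi := a1.continuous.integrable_of_hasCompactSupport (μ := volume) a2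
    have hTc : Continuous (molT φ T v) := molT_cont φ hφ hL0 hL ht v a1.continuous a2
    have iz := intB hz.continuousOn
    have iv : IntegrableOn v (ball 0 1) := hvi.integrableOn
    have iT : IntegrableOn (molT φ T v) (ball 0 1) := intB hTc.continuousOn
    have g1 : ∫ x in ball (0 : Euc n) 1, ‖z x - v x‖ ≤ ε / 3 := by
      have hsub : (ball (0 : Euc n) 1 \ closedBall 0 r) ⊆ ball 0 1 := Set.sdiff_subset
      rw [setIntegral_eq_of_subset_of_forall_sdiff_eq_zero measurableSet_ball hsub]
      · refine le_trans ?_ (hequi z hz hN _ hsub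
          (measurableSet_ball.diff measurableSet_closedBall) hr)
        refine integral_mono ((iz.sub iv).mono_set hsub).norm (iz.mono_set hsub).norm fun x => ?_
        have : z x - v x = (1 - ρ x) • z x := by rw [hv, sub_smul, one_smul]
        simp only [this, norm_smul]
        rw [Real.norm_of_nonneg (by linarith [h1 x])]
        exact mul_le_of_le_one_left (norm_nonneg _) (by linarith [h0 x])
      · rintro x ⟨hx1, hx2⟩
        have : x ∈ closedBall (0 : Euc n) r := by
          by_contra hh
          exact hx2 ⟨hx1, hh⟩
        simp [hv, hρ1 x this]
    have g2 : ∫ x in ball (0 : Euc n) 1, ‖v x - molT φ T v x‖ ≤ ε / 3 := by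
      have hle := molT_le A1 G φ hG hGi hφ hφi hφ1 hL0 hL hGφ v a1 a2 J
      have hI : IntegrableOn (fun x => v x - molT φ T v x) (ball 0 1) := iv.sub iT
      rw [integral_norm_eq_lintegral_enorm hI.aestronglyMeasurable]
      refine ENNReal.toReal_le_of_le_ofReal hε3.le ?_
      refine (setLIntegral_le_lintegral _ _).trans (hle.trans (ENNReal.ofReal_le_ofReal ?_))
      refine le_trans ?_ hJ
      rw [hM]
      gcongr
      refine a4.trans ?_
      gcongr
    have g3 : ∫ x in ball (0 : Euc n) 1, ‖molT φ T v x‖ ≤ ε / 3 := by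
      have hpt : ∀ x ∈ ball (0 : Euc n) 1, ‖molT φ T v x‖ ≤ 2 * η := by
        intro x hx
        obtain ⟨y, hy, hxy⟩ := Set.mem_iUnion₂.1 (hcov (ball_subset_closedBall hx))
        have hyF : ‖molT φ T v y‖ ≤ η :=
          (norm_le_pi_norm (F z) (⟨y, htfin.mem_toFinset.2 hy⟩ : t)).trans hF
        have hl := molT_lip φ hφ hL ht v a1.continuous a2 x y
        have hl2 : (T ^ n * (L * T) * ∫ y, ‖v y‖) * ‖x - y‖ ≤ Λ * s := by
          rw [mem_ball, dist_eq_norm] at hxy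
          rw [hΛ]
          gcongr
          exact a3.trans n1
        have hl3 : Λ * s ≤ η := by
          rw [hsdef, mul_div_assoc', div_le_iff₀ (by positivity)]
          nlinarith
        have := norm_sub_norm_le (molT φ T v x) (molT φ T v y)
        linarith
      have h2 : ∫ x in ball (0 : Euc n) 1, ‖molT φ T v x‖ ≤ ∫ x in ball (0 : Euc n) 1, 2 * η :=
        setIntegral_mono_on iT.norm (integrableOn_const measure_ball_lt_top.ne) measurableSet_ball
          hpt
      rw [setIntegral_const, smul_eq_mul, ← hvB] at h2
      refine h2.trans ?_
      have : vB * (2 * η) = ε / 3 * (vB / (vB + 1)) := by rw [hη]; field_simp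
      rw [this]
      exact mul_le_of_le_one_right hε3.le ((div_le_one (by positivity)).2 (by linarith))
    have g4 : ∫ x in ball (0 : Euc n) 1, ‖z x‖ ≤ (∫ x in ball (0 : Euc n) 1, ‖z x - v x‖)
        + (∫ x in ball (0 : Euc n) 1, ‖v x - molT φ T v x‖)
        + ∫ x in ball (0 : Euc n) 1, ‖molT φ T v x‖ := by
      have k1 : Integrable (fun x => ‖z x - v x‖) (volume.restrict (ball 0 1)) :=
        (iz.sub iv).norm
      have k2 : Integrable (fun x => ‖v x - molT φ T v x‖) (volume.restrict (ball 0 1)) :=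
        (iv.sub iT).norm
      have k3 := iT.norm
      rw [← integral_add k1 k2]
      have k12 := k1.add k2
      simp only [Pi.add_def] at k12
      rw [← integral_add k12 k3]
      refine integral_mono iz.norm (k12.add k3) fun x => ?_
      simp only [Pi.add_apply]
      calc ‖z x‖ = ‖(z x - v x) + (v x - molT φ T v x) + molT φ T v x‖ := by congr 1; abel
        _ ≤ _ := norm_add₃_le
    linarith

end Core


/-- (`k = 1`.) If the critical embedding estimate
`‖u‖_{L^{n/(n-1)}(B)} ≤ c (‖𝔸u‖_{L¹(B)} + ‖u‖_{L¹(B)})` holds on `C^∞(cl B, V)`, then for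
every `1 ≤ q < n/(n-1)` the set `F = {u ∈ C^∞(cl B, V) : ‖u‖_{L¹} + ‖𝔸u‖_{L¹} ≤ 1}`,
regarded as a subset of `L^q(B, V)` (via a.e. equality of the restriction), is totally
bounded. -/
theorem statement2 (hn : 1 < n) (A : OpCoeff n 1 V W)
    (h : ∃ c : ℝ, 0 < c ∧ ∀ u : Euc n → V, ContDiffOn ℝ (⊤ : ℕ∞) u (closedBall 0 1) →
      (∫ x in ball (0 : Euc n) 1, ‖u x‖ ^ ((n : ℝ) / (n - 1))) ^ (((n : ℝ) - 1) / n)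
        ≤ c * ((∫ x in ball (0 : Euc n) 1, ‖opApply A u x‖)
            + ∫ x in ball (0 : Euc n) 1, ‖u x‖))
    (q : ℝ) (hq1 : 1 ≤ q) (hq2 : q < (n : ℝ) / (n - 1)) :
    letI : Fact (1 ≤ ENNReal.ofReal q) := ⟨by
      simpa using ENNReal.ofReal_le_ofReal hq1⟩
    TotallyBounded {f : Lp V (ENNReal.ofReal q) (volume.restrict (ball (0 : Euc n) 1)) |
      ∃ u : Euc n → V, ContDiffOn ℝ (⊤ : ℕ∞) u (closedBall 0 1) ∧
        (∫ x in ball (0 : Euc n) 1, ‖u x‖)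
          + (∫ x in ball (0 : Euc n) 1, ‖opApply A u x‖) ≤ 1 ∧
        ∀ᵐ x ∂(volume.restrict (ball (0 : Euc n) 1)), f x = u x} := by
  obtain ⟨c, hc, hE0⟩ := h
  obtain ⟨A1, hA1⟩ := exists_A1 A
  have hE : Emb A1 c := by
    intro u hu
    have := hE0 u hu
    simp only [hA1] at this
    rw [add_comm] at this
    exact this
  have hq0 : 0 < q := by linarith
  have hF1 : Fact (1 ≤ ENNReal.ofReal q) := ⟨by simpa using ENNReal.ofReal_le_ofReal hq1⟩
  refine Metric.totallyBounded_of_finite_discretization fun ε hε => ?_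
  set p := (n : ℝ) / (n - 1) with hp
  set κ : ℝ := (ε / 2) ^ q with hκ
  have hκ0 : 0 < κ := by positivity
  obtain ⟨R, hR, hRκ⟩ := exists_R (s := p - q) (K := (c * 2) ^ p) (sub_pos.2 hq2) (half_pos hκ0)
  have hRq : 0 < R ^ (q - 1) := by positivity
  obtain ⟨t, F, C, η, hη, hadd, hbd, hcore⟩ :=
    core hn hc hE (ε := κ / 2 / R ^ (q - 1)) (by positivity)
  obtain ⟨N, -, hNfin, hcov⟩ :=
    (isCompact_closedBall (0 : t → V) C).finite_cover_balls (half_pos hη)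
  have hch : ∀ f : {f : Lp V (ENNReal.ofReal q) (volume.restrict (ball (0 : Euc n) 1)) |
      ∃ u : Euc n → V, ContDiffOn ℝ (⊤ : ℕ∞) u (closedBall 0 1) ∧
        (∫ x in ball (0 : Euc n) 1, ‖u x‖)
          + (∫ x in ball (0 : Euc n) 1, ‖opApply A u x‖) ≤ 1 ∧
        ∀ᵐ x ∂(volume.restrict (ball (0 : Euc n) 1)), f x = u x},
      ∃ (u : Euc n → V) (y : N), ContDiffOn ℝ (⊤ : ℕ∞) u (closedBall 0 1) ∧ nrmB A1 u ≤ 1 ∧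
        (f.1 =ᵐ[volume.restrict (ball (0 : Euc n) 1)] u) ∧ F u ∈ ball (y : t → V) (η / 2) := by
    rintro ⟨f, u, hu, hN, hf⟩
    simp only [hA1] at hN
    have h2 : F u ∈ closedBall (0 : t → V) C :=
      mem_closedBall_zero_iff.2 (hbd u hu (le_trans hN one_le_two))
    obtain ⟨y, hy, hyF⟩ := Set.mem_iUnion₂.1 (hcov h2)
    exact ⟨u, ⟨y, hy⟩, hu, hN, hf, hyF⟩
  choose U Y hU hUN hUf hUY using hch
  refine ⟨N, hNfin.fintype, Y, fun f g hfg => ?_⟩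
  set z : Euc n → V := fun x => U f x - U g x with hz
  have hzc : ContDiffOn ℝ (⊤ : ℕ∞) z (closedBall 0 1) := (hU f).sub (hU g)
  have hzN : nrmB A1 z ≤ 2 := by
    have := nrmB_sub A1 (hU f) (hU g)
    linarith [hUN f, hUN g]
  have hFz : ‖F z‖ ≤ η := by
    rw [hz, hadd _ _ (hU f) (hU g), ← dist_eq_norm]
    have h1 := hUY f
    have h2 := hUY g
    rw [← hfg] at h2
    rw [mem_ball] at h1 h2
    have := dist_triangle_right (F (U f)) (F (U g)) (Y f : t → V)
    linarith
  have hz1 := hcore z hzc hzN hFz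
  have hzp := bound_p hn hc hE hzc hzN
  rw [← hp] at hzp
  have hzq : ∫ x in ball (0 : Euc n) 1, ‖z x‖ ^ q ≤ κ := by
    have k1 : Integrable (fun x => R ^ (q - 1) * ‖z x‖) (volume.restrict (ball 0 1)) :=
      (intB hzc.continuousOn).norm.const_mul _
    have k2 : Integrable (fun x => R ^ (q - p) * ‖z x‖ ^ p) (volume.restrict (ball 0 1)) :=
      (intP hzc (by linarith)).const_mul _
    calc ∫ x in ball (0 : Euc n) 1, ‖z x‖ ^ q
        ≤ ∫ x in ball (0 : Euc n) 1, (R ^ (q - 1) * ‖z x‖ + R ^ (q - p) * ‖z x‖ ^ p) :=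
          integral_mono (intP hzc hq0.le) (k1.add k2) fun x => pw2 (norm_nonneg _) hR hq1 hq2
      _ = R ^ (q - 1) * (∫ x in ball (0 : Euc n) 1, ‖z x‖)
          + R ^ (q - p) * ∫ x in ball (0 : Euc n) 1, ‖z x‖ ^ p := by
          rw [integral_add k1 k2, integral_const_mul, integral_const_mul]
      _ ≤ R ^ (q - 1) * (κ / 2 / R ^ (q - 1)) + R ^ (q - p) * (c * 2) ^ p := by gcongr
      _ ≤ κ := by
          rw [mul_div_cancel₀ _ hRq.ne']
          have : q - p = -(p - q) := by ring
          rw [this]; linarith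
  have hae : (⇑f.1 - ⇑g.1) =ᵐ[volume.restrict (ball (0 : Euc n) 1)] z := (hUf f).sub (hUf g)
  have hmem : MemLp z (ENNReal.ofReal q) (volume.restrict (ball (0 : Euc n) 1)) :=
    ((Lp.memLp f.1).sub (Lp.memLp g.1)).ae_eq hae
  have hI0 : 0 ≤ ∫ x in ball (0 : Euc n) 1, ‖z x‖ ^ q := integral_nonneg fun x => by positivity
  rw [Lp.dist_def, eLpNorm_congr_ae hae, hmem.eLpNorm_eq_integral_rpow_norm
    (ENNReal.ofReal_pos.2 hq0).ne' ENNReal.ofReal_ne_top, ENNReal.toReal_ofReal hq0.le,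
    ENNReal.toReal_ofReal (by positivity)]
  calc _ ≤ κ ^ q⁻¹ := Real.rpow_le_rpow hI0 hzq (by positivity)
    _ = ε / 2 := by rw [hκ, Real.rpow_rpow_inv (by positivity) hq0.ne']
    _ < ε := by linarith
end
end

section
/- Let n>1 and let 𝔸 be a first-order (k=1) homogeneous linear constant-coefficient differential operator on ℝⁿ from V to W. Suppose the set F = { u ∈ C^∞(cl(B), V) : ‖u‖_{L¹(B)} + ‖𝔸u‖_{L¹(B)} ≤ 1 } is totally bounded as a subset of L¹(B, V). Then 𝔸 is ℂ-elliptic (equivalently, has finite-dimensional null-space). -/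
noncomputable section

open MeasureTheory Metric
open scoped ENNReal RealInnerProductSpace

variable {n k : ℕ} {V W : Type*}
  [NormedAddCommGroup V] [InnerProductSpace ℝ V] [FiniteDimensional ℝ V]
  [NormedAddCommGroup W] [InnerProductSpace ℝ W] [FiniteDimensional ℝ W]

section Helpers

open Polynomial

/-- The complex linear functional `x ↦ d (⟪η₁,x⟫ + i ⟪η₂,x⟫)`. -/
def cxFun (d : ℂ) (η₁ η₂ : Euc n) : Euc n →L[ℝ] ℂ :=
  d • (Complex.ofRealCLM.comp (innerSL ℝ η₁) + Complex.I • Complex.ofRealCLM.comp (innerSL ℝ η₂))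

lemma cxFun_apply (d : ℂ) (η₁ η₂ x : Euc n) :
    cxFun d η₁ η₂ x = d * ((⟪η₁, x⟫ : ℝ) + Complex.I * (⟪η₂, x⟫ : ℝ)) := by
  simp [cxFun, mul_add]

/-- The function `Re (p (g x) (a + i b))`. -/
def polyFun (g : Euc n →L[ℝ] ℂ) (a b : V) (p : ℝ[X]) (x : Euc n) : V :=
  (aeval (g x) p).re • a - (aeval (g x) p).im • b

lemma polyFun_contDiff (g : Euc n →L[ℝ] ℂ) (a b : V) (p : ℝ[X]) :
    ContDiff ℝ (⊤ : ℕ∞) (polyFun g a b p) := by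
  have h1 : ContDiff ℝ (⊤ : ℕ∞) (fun x : Euc n => aeval (g x) p) := by
    have h0 : ContDiff ℝ (⊤ : ℕ∞) (fun z : ℂ => aeval z p) :=
      (Polynomial.contDiff_aeval p (⊤ : ℕ∞) : ContDiff ℂ _ _).restrict_scalars ℝ
    exact h0.comp g.contDiff
  have hre := Complex.reCLM.contDiff.comp h1
  have him := Complex.imCLM.contDiff.comp h1
  exact (hre.smul contDiff_const).sub (him.smul contDiff_const)

lemma polyFun_hasFDerivAt (g : Euc n →L[ℝ] ℂ) (a b : V) (p : ℝ[X]) (x y : Euc n) :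
    fderiv ℝ (polyFun g a b p) x y =
      (aeval (g x) (derivative p) * g y).re • a - (aeval (g x) (derivative p) * g y).im • b := by
  have h0 := ((Polynomial.hasDerivAt_aeval p (g x)).hasFDerivAt.restrictScalars ℝ).comp x
    g.hasFDerivAt
  have hre := (Complex.reCLM.hasFDerivAt.comp x h0).smul_const a
  have him := (Complex.imCLM.hasFDerivAt.comp x h0).smul_const b
  have h := hre.sub him
  have h' : HasFDerivAt (polyFun g a b p) _ x := h
  rw [h'.fderiv]
  simp [mul_comm]

lemma polyFun_null (A : OpCoeff n 1 V W) (d : ℂ) (η₁ η₂ : Euc n) (a b : V)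
    (hre : A (cxSymTensorRe n 1 η₁ η₂ a b) = 0) (him : A (cxSymTensorIm n 1 η₁ η₂ a b) = 0)
    (p : ℝ[X]) (x : Euc n) : opApply A (polyFun (cxFun d η₁ η₂) a b p) x = 0 := by
  set e : ℂ := aeval (cxFun d η₁ η₂ x) (derivative p) * d with he
  have key : iteratedFDeriv ℝ 1 (polyFun (cxFun d η₁ η₂) a b p) x
      = e.re • cxSymTensorRe n 1 η₁ η₂ a b - e.im • cxSymTensorIm n 1 η₁ η₂ a b := by
    ext m
    rw [iteratedFDeriv_one_apply, polyFun_hasFDerivAt, cxFun_apply d η₁ η₂ (m 0), ← mul_assoc, ← he]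
    simp [cxSymTensorRe, cxSymTensorIm, cxKernel]
    module
  rw [opApply, key, map_sub, map_smul, map_smul, hre, him]
  simp

lemma polyFun_memLp (g : Euc n →L[ℝ] ℂ) (a b : V) (p : ℝ[X]) :
    MemLp (polyFun g a b p) 1 (volume.restrict (ball (0 : Euc n) 1)) := by
  rw [memLp_one_iff_integrable]
  have : IntegrableOn (polyFun g a b p) (closedBall (0 : Euc n) 1) volume :=
    (polyFun_contDiff g a b p).continuous.continuousOn.integrableOn_compact
      (isCompact_closedBall _ _)
  exact this.mono_set ball_subset_closedBall

/-- The linear map sending a real polynomial to the class of `polyFun`. -/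
def polyLp (g : Euc n →L[ℝ] ℂ) (a b : V) :
    ℝ[X] →ₗ[ℝ] Lp V 1 (volume.restrict (ball (0 : Euc n) 1)) where
  toFun p := (polyFun_memLp g a b p).toLp _
  map_add' p q := by
    rw [← MemLp.toLp_add]
    congr 1
    ext x
    simp [polyFun]
    module
  map_smul' r p := by
    rw [RingHom.id_apply, ← MemLp.toLp_const_smul]
    congr 1
    ext x
    simp [polyFun]
    module

lemma polyLp_coe (g : Euc n →L[ℝ] ℂ) (a b : V) (p : ℝ[X]) :
    polyLp g a b p =ᵐ[volume.restrict (ball (0 : Euc n) 1)] polyFun g a b p :=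
  (polyFun_memLp g a b p).coeFn_toLp

lemma polyLp_injective (g : Euc n →L[ℝ] ℂ) (a b : V) (ha : a ≠ 0) (x₀ : Euc n)
    (hx₀ : g x₀ = 1) : Function.Injective (polyLp g a b) := by
  rw [injective_iff_map_eq_zero]
  intro p hp
  have h1 : polyFun g a b p =ᵐ[volume.restrict (ball (0 : Euc n) 1)] (fun _ => (0 : V)) := by
    have h2 := polyLp_coe g a b p
    rw [hp] at h2
    exact h2.symm.trans (Lp.coeFn_zero _ _ _)
  have h2 : Set.EqOn (polyFun g a b p) (fun _ => (0 : V)) (ball (0 : Euc n) 1) :=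
    Measure.eqOn_open_of_ae_eq h1 isOpen_ball
      (polyFun_contDiff g a b p).continuous.continuousOn continuousOn_const
  have hcont : Continuous (fun t : ℝ => t • x₀) := by fun_prop
  have h3 : ∀ᶠ t : ℝ in nhds 0, t • x₀ ∈ ball (0 : Euc n) 1 := by
    apply hcont.continuousAt.eventually_mem
    apply isOpen_ball.mem_nhds
    simp
  have h4 : ∀ᶠ t : ℝ in nhds 0, p.eval t = 0 := by
    filter_upwards [h3] with t ht
    have h5 := h2 ht
    have h6 : aeval (g (t • x₀)) p = ((p.eval t : ℝ) : ℂ) := by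
      rw [map_smul, hx₀]
      have : t • (1 : ℂ) = algebraMap ℝ ℂ t := by simp
      rw [this, aeval_algebraMap_apply]
      simp
    simp only [polyFun, h6, Complex.ofReal_re, Complex.ofReal_im, zero_smul, sub_zero] at h5
    exact (smul_eq_zero.mp h5).resolve_right ha
  apply Polynomial.eq_zero_of_infinite_isRoot
  exact infinite_of_mem_nhds (0 : ℝ) h4

lemma not_totallyBounded_of_sep {E : Type*} [PseudoMetricSpace E] {S : Set E} (f : ℕ → E)
    (hf : ∀ i, f i ∈ S) {ε : ℝ} (hε : 0 < ε) (hsep : ∀ i j, i ≠ j → ε ≤ dist (f i) (f j)) :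
    ¬ TotallyBounded S := by
  intro h
  obtain ⟨t, ht, hcov⟩ := Metric.totallyBounded_iff.mp h (ε / 2) (by positivity)
  have h1 : ∀ i, ∃ y ∈ t, dist (f i) y < ε / 2 := by
    intro i
    simpa using hcov (hf i)
  choose y hyt hy using h1
  obtain ⟨i, -, j, -, hij, he⟩ :=
    Set.infinite_univ.exists_ne_map_eq_of_mapsTo (f := y) (fun i _ => hyt i) ht
  have := hsep i j hij
  have h2 := dist_triangle_right (f i) (f j) (y i)
  have h3 := hy i
  have h4 := hy j
  rw [← he] at h4
  linarith

lemma main_aux (A : OpCoeff n 1 V W)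
    (h : TotallyBounded {f : Lp V 1 (volume.restrict (ball (0 : Euc n) 1)) |
      ∃ u : Euc n → V, ContDiffOn ℝ (⊤ : ℕ∞) u (closedBall 0 1) ∧
        (∫ x in ball (0 : Euc n) 1, ‖u x‖)
          + (∫ x in ball (0 : Euc n) 1, ‖opApply A u x‖) ≤ 1 ∧
        ∀ᵐ x ∂(volume.restrict (ball (0 : Euc n) 1)), f x = u x})
    (η₁ η₂ : Euc n) (a b : V) (hη : (η₁, η₂) ≠ 0)
    (hre : A (cxSymTensorRe n 1 η₁ η₂ a b) = 0) (him : A (cxSymTensorIm n 1 η₁ η₂ a b) = 0) :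
    a = 0 := by
  by_contra ha
  obtain ⟨x₀, hx₀⟩ : ∃ x₀ : Euc n, ((⟪η₁, x₀⟫ : ℝ) + Complex.I * (⟪η₂, x₀⟫ : ℝ) : ℂ) ≠ 0 := by
    by_contra! hc
    apply hη
    have h1 := congrArg Complex.re (hc η₁)
    have h2 := congrArg Complex.im (hc η₂)
    simp only [Complex.add_re, Complex.add_im, Complex.I_mul_re, Complex.I_mul_im,
      Complex.ofReal_re, Complex.ofReal_im, neg_zero, add_zero, zero_add, Complex.zero_re,
      Complex.zero_im, inner_self_eq_zero] at h1 h2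
    simp [h1, h2]
  set d : ℂ := ((⟪η₁, x₀⟫ : ℝ) + Complex.I * (⟪η₂, x₀⟫ : ℝ) : ℂ)⁻¹ with hd
  set g := cxFun d η₁ η₂ with hg
  have hgx : g x₀ = 1 := by
    rw [hg, cxFun_apply, hd, inv_mul_cancel₀ hx₀]
  have hinj := polyLp_injective g a b ha x₀ hgx
  have hfin : ¬ FiniteDimensional ℝ (LinearMap.range (polyLp g a b)) := by
    intro hf
    exact Polynomial.not_finite (R := ℝ)
      (Module.Finite.equiv (LinearEquiv.ofInjective _ hinj).symm)
  obtain ⟨R, f, hR, hfR, hsep⟩ := exists_seq_norm_le_one_le_norm_sub (𝕜 := ℝ) hfin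
  have hR0 : (0 : ℝ) < R := by linarith
  refine not_totallyBounded_of_sep
    (fun i => R⁻¹ • (f i : Lp V 1 (volume.restrict (ball (0 : Euc n) 1)))) ?_
    (inv_pos.mpr hR0) ?_ h
  · intro i
    obtain ⟨p, hp⟩ := (f i).2
    have hpe : R⁻¹ • (f i : Lp V 1 (volume.restrict (ball (0 : Euc n) 1)))
        = polyLp g a b (R⁻¹ • p) := by rw [map_smul, hp]
    refine ⟨polyFun g a b (R⁻¹ • p), (polyFun_contDiff g a b _).contDiffOn, ?_, ?_⟩
    · have h0 : ∀ x, opApply A (polyFun g a b (R⁻¹ • p)) x = 0 :=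
        polyFun_null A d η₁ η₂ a b hre him _
      simp only [h0, norm_zero, integral_zero, add_zero]
      have h1 : (∫ x in ball (0 : Euc n) 1, ‖polyFun g a b (R⁻¹ • p) x‖)
          = ‖polyLp g a b (R⁻¹ • p)‖ := by
        rw [L1.norm_eq_integral_norm]
        apply integral_congr_ae
        filter_upwards [polyLp_coe g a b (R⁻¹ • p)] with x hx
        rw [hx]
      rw [h1, ← hpe, norm_smul, norm_inv, Real.norm_of_nonneg hR0.le, inv_mul_le_one₀ hR0]
      exact hfR i
    · have := polyLp_coe g a b (R⁻¹ • p)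
      simp only [hpe]
      exact this
  · intro i j hij
    have h1 := hsep hij
    simp only [dist_eq_norm]
    rw [← smul_sub, norm_smul, norm_inv, Real.norm_of_nonneg hR0.le]
    have h2 : (1 : ℝ) ≤ ‖(f i : Lp V 1 (volume.restrict (ball (0 : Euc n) 1))) - f j‖ := h1
    exact le_mul_of_one_le_right (inv_pos.mpr hR0).le h2

end Helpers

/-- (`k = 1`.) If the set
`F = {u ∈ C^∞(cl B, V) : ‖u‖_{L¹(B)} + ‖𝔸u‖_{L¹(B)} ≤ 1}`, regarded as a subset of
`L¹(B, V)`, is totally bounded, then `𝔸` is ℂ-elliptic (equivalently, has FDN). -/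
theorem statement3 (hn : 1 < n) (A : OpCoeff n 1 V W)
    (h : TotallyBounded {f : Lp V 1 (volume.restrict (ball (0 : Euc n) 1)) |
      ∃ u : Euc n → V, ContDiffOn ℝ (⊤ : ℕ∞) u (closedBall 0 1) ∧
        (∫ x in ball (0 : Euc n) 1, ‖u x‖)
          + (∫ x in ball (0 : Euc n) 1, ‖opApply A u x‖) ≤ 1 ∧
        ∀ᵐ x ∂(volume.restrict (ball (0 : Euc n) 1)), f x = u x}) :
    IsCElliptic A := by
  intro η₁ η₂ v₁ v₂ hη hre him
  refine ⟨main_aux A h η₁ η₂ v₁ v₂ hη hre him, main_aux A h η₁ η₂ v₂ (-v₁) hη ?_ ?_⟩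
  · rw [← him]
    congr 1
    ext m
    simp [cxSymTensorRe, cxSymTensorIm]
    abel
  · have : cxSymTensorIm n 1 η₁ η₂ v₂ (-v₁) = - cxSymTensorRe n 1 η₁ η₂ v₁ v₂ := by
      ext m
      simp [cxSymTensorRe, cxSymTensorIm]
      abel
    rw [this, map_neg, hre, neg_zero]
end
end

section
/- Let n>1 and let 𝔸 be a homogeneous linear constant-coefficient differential operator of order k on ℝⁿ from V to W. Then the real vector space { u ∈ C^∞(ℝⁿ, V) : 𝔸u = 0 on ℝⁿ } is finite-dimensional if and only if 𝔸 is ℂ-elliptic, i.e. the complexified symbol 𝔸[ξ] : V+iV → W+iW is injective for every ξ ∈ ℂⁿ\{0}. -/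
noncomputable section

open MeasureTheory Metric
open scoped ENNReal RealInnerProductSpace

variable {n k : ℕ} {V W : Type*}
  [NormedAddCommGroup V] [InnerProductSpace ℝ V] [FiniteDimensional ℝ V]
  [NormedAddCommGroup W] [InnerProductSpace ℝ W] [FiniteDimensional ℝ W]

section Helpers

/-- Smooth complex-valued functions. -/
def SmE (n : ℕ) : Submodule ℂ (Euc n → ℂ) where
  carrier := {u | ContDiff ℝ (⊤ : ℕ∞) u}
  zero_mem' := by
    change ContDiff ℝ (⊤ : ℕ∞) (fun _ => (0 : ℂ))
    exact contDiff_const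
  add_mem' := by
    intro a b (ha : ContDiff ℝ (⊤ : ℕ∞) a) (hb : ContDiff ℝ (⊤ : ℕ∞) b)
    exact ContDiff.add ha hb
  smul_mem' := by
    intro c u (hu : ContDiff ℝ (⊤ : ℕ∞) u)
    exact ContDiff.const_smul c hu

lemma SmE.contDiff {n : ℕ} (u : SmE n) : ContDiff ℝ (⊤ : ℕ∞) u.1 := u.2

/-- Standard basis vector. -/
def eb {n : ℕ} (i : Fin n) : Euc n := EuclideanSpace.single i 1

lemma smooth_fderiv {n : ℕ} {F : Type*} [NormedAddCommGroup F] [NormedSpace ℝ F] {u : Euc n → F}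
    (hu : ContDiff ℝ (⊤ : ℕ∞) u) : ContDiff ℝ (⊤ : ℕ∞) (fderiv ℝ u) :=
  hu.fderiv_right (by simp)

/-- Partial derivatives. -/
def pd {n : ℕ} (i : Fin n) : Module.End ℂ (SmE n) where
  toFun u := ⟨fun x => fderiv ℝ u.1 x (eb i),
    (smooth_fderiv (SmE.contDiff u)).clm_apply contDiff_const⟩
  map_add' u v := by
    ext x
    have hu : DifferentiableAt ℝ u.1 x := ((SmE.contDiff u).differentiable (by simp)) x
    have hv : DifferentiableAt ℝ v.1 x := ((SmE.contDiff v).differentiable (by simp)) x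
    change fderiv ℝ (u.1 + v.1) x (eb i) = fderiv ℝ u.1 x (eb i) + fderiv ℝ v.1 x (eb i)
    simp [fderiv_add hu hv]
  map_smul' c u := by
    ext x
    have hu : DifferentiableAt ℝ u.1 x := ((SmE.contDiff u).differentiable (by simp)) x
    change fderiv ℝ (c • u.1) x (eb i) = c • fderiv ℝ u.1 x (eb i)
    simp [fderiv_const_smul hu]

lemma pd_apply {n : ℕ} (i : Fin n) (u : SmE n) (x : Euc n) :
    (pd i u).1 x = fderiv ℝ u.1 x (eb i) := rfl

lemma pd_comm {n : ℕ} (i j : Fin n) : pd i * pd j = pd j * pd i := by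
  ext u x
  have hu : ContDiff ℝ (⊤ : ℕ∞) u.1 := u.2
  have hd : DifferentiableAt ℝ (fderiv ℝ u.1) x := (smooth_fderiv hu).differentiable (by simp) x
  have key : ∀ a b : Fin n, ((pd a * pd b) u).1 x = fderiv ℝ (fderiv ℝ u.1) x (eb a) (eb b) := by
    intro a b
    change fderiv ℝ (fun y => fderiv ℝ u.1 y (eb b)) x (eb a) = _
    rw [fderiv_clm_apply hd (by fun_prop)]
    simp
  rw [key, key]
  have := (hu.contDiffAt (x := x)).isSymmSndFDerivAt (by simp; exact WithTop.coe_le_coe.2 le_top)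
  exact this _ _

open scoped IsMulCommutative in
/-- The action of polynomials by constant coefficient operators. -/
def rho (n : ℕ) : MvPolynomial (Fin n) ℂ →ₐ[ℂ] Module.End ℂ (SmE n) :=
  haveI : IsMulCommutative (Algebra.adjoin ℂ (Set.range (pd (n := n)))) :=
    Algebra.isMulCommutative_adjoin ℂ (by
      rintro _ ⟨i, rfl⟩ _ ⟨j, rfl⟩
      exact pd_comm i j)
  (Algebra.adjoin ℂ (Set.range (pd (n := n)))).val.comp
    (MvPolynomial.aeval (R := ℂ) (S₁ := Algebra.adjoin ℂ (Set.range (pd (n := n))))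
      (fun i : Fin n => (⟨pd i, Algebra.subset_adjoin ⟨i, rfl⟩⟩ :
        Algebra.adjoin ℂ (Set.range (pd (n := n))))))

lemma rho_X {n : ℕ} (i : Fin n) : rho n (MvPolynomial.X i) = pd i := by
  simp [rho]

lemma rho_word {n : ℕ} (u : SmE n) : ∀ (k : ℕ) (f : Fin k → Fin n) (x : Euc n),
    (rho n (∏ i, MvPolynomial.X (f i)) u).1 x = iteratedFDeriv ℝ k u.1 x (fun i => eb (f i)) := by
  intro k
  induction k with
  | zero => intro f x; simp
  | succ k ih =>
    intro f x
    rw [Fin.prod_univ_succ, map_mul, rho_X, Module.End.mul_apply, pd_apply,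
      iteratedFDeriv_succ_apply_left]
    have : (rho n (∏ i : Fin k, MvPolynomial.X (f i.succ)) u).1
        = fun y => iteratedFDeriv ℝ k u.1 y (fun i => eb (f i.succ)) := funext (ih _)
    rw [this, fderiv_continuousMultilinear_apply_const]
    · rfl
    · have hu : ContDiff ℝ (⊤ : ℕ∞) u.1 := u.2
      exact hu.differentiable_iteratedFDeriv (by exact_mod_cast WithTop.coe_lt_top k) x

/-- The elementary tensor `dx_f ⊗ v`. -/
def dxT {n k : ℕ} {V : Type*} [NormedAddCommGroup V] [NormedSpace ℝ V]
    (f : Fin k → Fin n) (v : V) : ContinuousMultilinearMap ℝ (fun _ : Fin k => Euc n) V :=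
  (ContinuousMultilinearMap.mkPiRing ℝ (Fin k) v).compContinuousLinearMap
    (fun i => (EuclideanSpace.proj (f i) : Euc n →L[ℝ] ℝ))

lemma dxT_apply {n k : ℕ} {V : Type*} [NormedAddCommGroup V] [NormedSpace ℝ V]
    (f : Fin k → Fin n) (v : V) (m : Fin k → Euc n) :
    dxT f v m = (∏ i, m i (f i)) • v := by
  simp [dxT]

lemma tensor_expand {n k : ℕ} {V : Type*} [NormedAddCommGroup V] [NormedSpace ℝ V]
    (c : ContinuousMultilinearMap ℝ (fun _ : Fin k => Euc n) V) :
    c = ∑ f : Fin k → Fin n, dxT f (c (fun i => eb (f i))) := by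
  ext m
  have hm : m = fun i => ∑ j, (m i j) • (eb j : Euc n) := by
    funext i
    ext l
    simp [eb, Pi.single_apply]
  have : c m = c (fun i => ∑ j, (m i j) • (eb j : Euc n)) := by rw [← hm]
  rw [this, ContinuousMultilinearMap.map_sum, _root_.sum_apply]
  refine Finset.sum_congr rfl fun f _ => ?_
  rw [dxT_apply, ContinuousMultilinearMap.map_smul_univ]


lemma cxKernel_eb {n k : ℕ} (η₁ η₂ : Euc n) (m : Fin k → Euc n) :
    cxKernel n k η₁ η₂ m
      = ∏ i, (((inner ℝ η₁ (m i) : ℝ) : ℂ) + Complex.I * ((inner ℝ η₂ (m i) : ℝ) : ℂ)) := by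
  simp [cxKernel]

/-- Coordinate coefficients of the operator. -/
def coefA (A : OpCoeff n k V W) (f : Fin k → Fin n)
    (w : Fin (Module.finrank ℝ W)) (j : Fin (Module.finrank ℝ V)) : ℝ :=
  (Module.finBasis ℝ W).repr (A (dxT f (Module.finBasis ℝ V j))) w

lemma coordA (A : OpCoeff n k V W) (c : ContinuousMultilinearMap ℝ (fun _ : Fin k => Euc n) V)
    (w : Fin (Module.finrank ℝ W)) :
    (Module.finBasis ℝ W).repr (A c) w = ∑ f : Fin k → Fin n, ∑ j,
      (Module.finBasis ℝ V).repr (c (fun i => eb (f i))) j * coefA A f w j := by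
  have key : ∀ (f : Fin k → Fin n) (v : V), (dxT f v : ContinuousMultilinearMap ℝ _ V)
      = ∑ j, (Module.finBasis ℝ V).repr v j • dxT f (Module.finBasis ℝ V j) := by
    intro f v
    ext m
    rw [dxT_apply, _root_.sum_apply]
    simp only [_root_.smul_apply, dxT_apply]
    conv_lhs => rw [← (Module.finBasis ℝ V).sum_repr v, Finset.smul_sum]
    exact Finset.sum_congr rfl fun j _ => smul_comm _ _ _
  conv_lhs => rw [tensor_expand c, map_sum, map_sum, Finsupp.finsetSum_apply]
  refine Finset.sum_congr rfl fun f _ => ?_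
  rw [key f, map_sum, map_sum, Finsupp.finsetSum_apply]
  refine Finset.sum_congr rfl fun j _ => ?_
  simp [coefA]

/-- The polynomial matrix of the symbol. -/
def symMat (A : OpCoeff n k V W) :
    Matrix (Fin (Module.finrank ℝ W)) (Fin (Module.finrank ℝ V)) (MvPolynomial (Fin n) ℂ) :=
  fun w j => ∑ f : Fin k → Fin n,
    MvPolynomial.C ((coefA A f w j : ℝ) : ℂ) * ∏ i, MvPolynomial.X (f i)

lemma symMat_inj (A : OpCoeff n k V W) (hA : IsCElliptic A) (ξ : Fin n → ℂ) (hξ : ξ ≠ 0)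
    (z : Fin (Module.finrank ℝ V) → ℂ)
    (hz : ((symMat A).map (MvPolynomial.aeval ξ)).mulVec z = 0) : z = 0 := by
  set η₁ : Euc n := WithLp.toLp 2 (fun i => (ξ i).re) with h1
  set η₂ : Euc n := WithLp.toLp 2 (fun i => (ξ i).im) with h2
  set v₁ : V := (Module.finBasis ℝ V).equivFun.symm (fun j => (z j).re) with hv1
  set v₂ : V := (Module.finBasis ℝ V).equivFun.symm (fun j => (z j).im) with hv2
  have hne : (η₁, η₂) ≠ 0 := by
    intro h
    apply hξ
    funext i
    have e1 : η₁ = 0 := congrArg Prod.fst h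
    have e2 : η₂ = 0 := congrArg Prod.snd h
    have e1' : η₁ i = 0 := by rw [e1]; rfl
    have e2' : η₂ i = 0 := by rw [e2]; rfl
    exact Complex.ext e1' e2'
  have hker : ∀ f : Fin k → Fin n, cxKernel n k η₁ η₂ (fun i => eb (f i)) = ∏ i, ξ (f i) := by
    intro f
    rw [cxKernel_eb]
    refine Finset.prod_congr rfl fun i _ => ?_
    simp only [eb, h1, h2, EuclideanSpace.inner_single_right]
    apply Complex.ext <;> simp
  have hr1 : ∀ j, (Module.finBasis ℝ V).repr v₁ j = (z j).re := by
    intro j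
    rw [← Module.Basis.equivFun_apply, hv1, LinearEquiv.apply_symm_apply]
  have hr2 : ∀ j, (Module.finBasis ℝ V).repr v₂ j = (z j).im := by
    intro j
    rw [← Module.Basis.equivFun_apply, hv2, LinearEquiv.apply_symm_apply]
  have hmv : ∀ w, ∑ f : Fin k → Fin n, ∑ j, (∏ i, ξ (f i)) * z j * (coefA A f w j : ℂ) = 0 := by
    intro w
    have := congrFun hz w
    simp only [Matrix.mulVec, dotProduct, Matrix.map_apply, symMat, map_sum, map_mul,
      map_prod, MvPolynomial.aeval_X, MvPolynomial.aeval_C, Finset.sum_mul] at this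
    rw [Finset.sum_comm]
    refine Eq.trans ?_ this
    refine Finset.sum_congr rfl fun j _ => Finset.sum_congr rfl fun f _ => ?_
    simp only [Algebra.algebraMap_self, RingHom.id_apply]
    ring
  have hre : A (cxSymTensorRe n k η₁ η₂ v₁ v₂) = 0 := by
    apply (Module.finBasis ℝ W).repr.injective
    ext w
    rw [coordA, map_zero, Finsupp.zero_apply]
    have := congrArg Complex.re (hmv w)
    simp only [Complex.re_sum, Complex.zero_re] at this
    rw [← this]
    refine Finset.sum_congr rfl fun f _ => Finset.sum_congr rfl fun j _ => ?_
    simp [cxSymTensorRe, hker, hr1, hr2]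
  have him : A (cxSymTensorIm n k η₁ η₂ v₁ v₂) = 0 := by
    apply (Module.finBasis ℝ W).repr.injective
    ext w
    rw [coordA, map_zero, Finsupp.zero_apply]
    have := congrArg Complex.im (hmv w)
    simp only [Complex.im_sum, Complex.zero_im] at this
    rw [← this]
    refine Finset.sum_congr rfl fun f _ => Finset.sum_congr rfl fun j _ => ?_
    simp [cxSymTensorIm, hker, hr1, hr2]
    left
    ring
  obtain ⟨a1, a2⟩ := hA η₁ η₂ v₁ v₂ hne hre him
  funext j
  apply Complex.ext
  · rw [← hr1, a1]; simp
  · rw [← hr2, a2]; simp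

/-- Complex coordinate functional. -/
def phi (V : Type*) [NormedAddCommGroup V] [InnerProductSpace ℝ V] [FiniteDimensional ℝ V]
    (j : Fin (Module.finrank ℝ V)) : V →L[ℝ] ℂ :=
  Complex.ofRealCLM.comp (LinearMap.toContinuousLinearMap ((Module.finBasis ℝ V).coord j))

lemma phi_apply (j : Fin (Module.finrank ℝ V)) (v : V) :
    phi V j v = ((Module.finBasis ℝ V).repr v j : ℂ) := by
  simp [phi]

/-- Complex coordinates of a smooth function. -/
def cU (u : Euc n → V) (hu : ContDiff ℝ (⊤ : ℕ∞) u) (j : Fin (Module.finrank ℝ V)) : SmE n :=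
  ⟨fun x => phi V j (u x), (phi V j).contDiff.comp hu⟩

lemma cU_word (u : Euc n → V) (hu : ContDiff ℝ (⊤ : ℕ∞) u) (j : Fin (Module.finrank ℝ V))
    (l : ℕ) (f : Fin l → Fin n) (x : Euc n) :
    (rho n (∏ i, MvPolynomial.X (f i)) (cU u hu j)).1 x
      = phi V j (iteratedFDeriv ℝ l u x (fun i => eb (f i))) := by
  rw [rho_word]
  have := (phi V j).iteratedFDeriv_comp_left (hu.contDiffAt (x := x)) (i := l)
    (WithTop.coe_le_coe.2 le_top)
  change iteratedFDeriv ℝ l (phi V j ∘ u) x _ = _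
  rw [this]
  rfl

lemma null_eq (A : OpCoeff n k V W) (u : Euc n → V) (hu : ContDiff ℝ (⊤ : ℕ∞) u)
    (h0 : ∀ x, opApply A u x = 0) (w : Fin (Module.finrank ℝ W)) :
    ∑ j, rho n (symMat A w j) (cU u hu j) = 0 := by
  ext x
  have := coordA A (iteratedFDeriv ℝ k u x) w
  have h := h0 x
  rw [opApply] at h
  rw [h, map_zero, Finsupp.zero_apply] at this
  have t2 := congrArg (fun r : ℝ => (r : ℂ)) this
  simp only [Complex.ofReal_zero, Complex.ofReal_sum, Complex.ofReal_mul] at t2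
  rw [Finset.sum_comm] at t2
  simp only [Submodule.coe_sum, Finset.sum_apply, Submodule.coe_zero, Pi.zero_apply]
  rw [t2]
  refine Finset.sum_congr rfl fun j _ => ?_
  simp only [symMat, map_sum, LinearMap.sum_apply, Submodule.coe_sum, Finset.sum_apply]
  refine Finset.sum_congr rfl fun f _ => ?_
  rw [← MvPolynomial.smul_eq_C_mul, map_smul]
  change ((coefA A f w j : ℝ) : ℂ) * (rho n (∏ i, MvPolynomial.X (f i)) (cU u hu j)).1 x = _
  rw [cU_word, phi_apply, mul_comm]

/-- Annihilating ideal. -/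
def annI (A : OpCoeff n k V W) : Ideal (MvPolynomial (Fin n) ℂ) where
  carrier := {p | ∀ (u : Euc n → V) (hu : ContDiff ℝ (⊤ : ℕ∞) u), (∀ x, opApply A u x = 0) →
    ∀ j, rho n p (cU u hu j) = 0}
  zero_mem' := by intro u hu h j; simp
  add_mem' := by intro a b ha hb u hu h j; simp [ha u hu h j, hb u hu h j]
  smul_mem' := by intro c a ha u hu h j; simp [ha u hu h j]

lemma det_mem (A : OpCoeff n k V W)
    (C : Matrix (Fin (Module.finrank ℝ V)) (Fin (Module.finrank ℝ W)) (MvPolynomial (Fin n) ℂ)) :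
    (C * symMat A).det ∈ annI A := by
  intro u hu h j
  set B := C * symMat A with hB
  have h1 : ∀ i, ∑ j, rho n (B i j) (cU u hu j) = 0 := by
    intro i
    simp only [hB, Matrix.mul_apply, map_sum, map_mul, LinearMap.sum_apply, Module.End.mul_apply]
    rw [Finset.sum_comm]
    refine Finset.sum_eq_zero fun w _ => ?_
    rw [← map_sum, null_eq A u hu h w, map_zero]
  have h2 : ∑ l, rho n ((B.adjugate * B) j l) (cU u hu l) = 0 := by
    simp only [Matrix.mul_apply, map_sum, map_mul, LinearMap.sum_apply, Module.End.mul_apply]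
    rw [Finset.sum_comm]
    refine Finset.sum_eq_zero fun w _ => ?_
    rw [← map_sum, h1 w, map_zero]
  rw [Matrix.adjugate_mul] at h2
  rw [Finset.sum_eq_single j] at h2
  · simpa using h2
  · intro l _ hl
    simp [hl.symm]
  · simp

lemma X_mem_radical (A : OpCoeff n k V W) (hA : IsCElliptic A) (i : Fin n) :
    MvPolynomial.X i ∈ (annI A).radical := by
  rw [← MvPolynomial.vanishingIdeal_zeroLocus_eq_radical (K := ℂ)]
  intro ξ hξ
  rw [MvPolynomial.mem_zeroLocus_iff] at hξ
  by_cases h0 : ξ = 0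
  · simp [h0]
  exfalso
  set S := (symMat A).map (MvPolynomial.aeval ξ) with hS
  have hinj : LinearMap.ker (Matrix.toLin' S) = ⊥ := by
    rw [LinearMap.ker_eq_bot']
    intro z hz
    exact symMat_inj A hA ξ h0 z hz
  obtain ⟨g, hg⟩ := LinearMap.exists_leftInverse_of_injective _ hinj
  set G := LinearMap.toMatrix' g with hG
  have hGS : G * S = 1 := by
    have := congrArg LinearMap.toMatrix' hg
    rwa [LinearMap.toMatrix'_comp, LinearMap.toMatrix'_toLin', LinearMap.toMatrix'_id] at this
  set Cm : Matrix (Fin (Module.finrank ℝ V)) (Fin (Module.finrank ℝ W)) (MvPolynomial (Fin n) ℂ) :=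
    G.map MvPolynomial.C with hC
  have h3 : MvPolynomial.aeval ξ (Cm * symMat A).det = 0 := hξ _ (det_mem A Cm)
  have e : (Cm * symMat A).map (MvPolynomial.aeval ξ) = G * S := by
    ext a b
    rw [Matrix.map_apply, Matrix.mul_apply, Matrix.mul_apply, map_sum]
    refine Finset.sum_congr rfl fun w _ => ?_
    rw [map_mul, hC, hS, Matrix.map_apply, Matrix.map_apply, MvPolynomial.aeval_C]
    rfl
  have h4 : ((Cm * symMat A).map (MvPolynomial.aeval ξ)).det = 0 := by
    rw [← h3]
    exact ((MvPolynomial.aeval ξ).map_det (Cm * symMat A)).symm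
  rw [e, hGS, Matrix.det_one] at h4
  exact one_ne_zero h4

lemma exists_order (A : OpCoeff n k V W) (hA : IsCElliptic A) :
    ∃ L : ℕ, ∀ u ∈ nullSpace A, ∀ x, iteratedFDeriv ℝ L u x = 0 := by
  have hle : Ideal.span (Set.range (MvPolynomial.X (R := ℂ) (σ := Fin n))) ≤ (annI A).radical := by
    rw [Ideal.span_le]
    rintro _ ⟨i, rfl⟩
    exact X_mem_radical A hA i
  obtain ⟨L, hL⟩ := Ideal.exists_pow_le_of_le_radical_of_fg hle
    (IsNoetherian.noetherian _)
  refine ⟨L, fun u ⟨hu, h0⟩ x => ?_⟩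
  rw [tensor_expand (iteratedFDeriv ℝ L u x)]
  refine Finset.sum_eq_zero fun f _ => ?_
  have hm : ∏ i, MvPolynomial.X (f i) ∈ annI A := by
    apply hL
    have := Ideal.prod_mem_prod (s := Finset.univ)
      (I := fun _ : Fin L => Ideal.span (Set.range (MvPolynomial.X (R := ℂ) (σ := Fin n))))
      (x := fun i => MvPolynomial.X (f i)) (fun i _ => Ideal.subset_span ⟨_, rfl⟩)
    simpa using this
  have : iteratedFDeriv ℝ L u x (fun i => eb (f i)) = 0 := by
    apply (Module.finBasis ℝ V).repr.injective
    ext j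
    have := cU_word u hu j L f x
    rw [hm u hu h0 j, phi_apply] at this
    simpa using this.symm
  rw [this]
  ext m
  simp [dxT_apply]

/-- Smooth maps with vanishing `L`-th derivative. -/
def polySub (n : ℕ) (V : Type*) [NormedAddCommGroup V] [InnerProductSpace ℝ V] (L : ℕ) :
    Submodule ℝ (Euc n → V) where
  carrier := {u | ContDiff ℝ (⊤ : ℕ∞) u ∧ ∀ x, iteratedFDeriv ℝ L u x = 0}
  zero_mem' := by
    refine ⟨contDiff_const (c := (0 : V)), fun x => ?_⟩
    change iteratedFDeriv ℝ L (fun _ => (0 : V)) x = 0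
    simp
  add_mem' := by
    rintro a b ⟨ha, ha'⟩ ⟨hb, hb'⟩
    refine ⟨ha.add hb, fun x => ?_⟩
    have h : ((L : ℕ∞) : WithTop ℕ∞) ≤ ((⊤ : ℕ∞) : WithTop ℕ∞) := WithTop.coe_le_coe.2 le_top
    rw [iteratedFDeriv_add_apply (ha.of_le h).contDiffAt (hb.of_le h).contDiffAt, ha', hb', add_zero]
  smul_mem' := by
    rintro c u ⟨hu, hu'⟩
    refine ⟨hu.const_smul c, fun x => ?_⟩
    have h : ((L : ℕ∞) : WithTop ℕ∞) ≤ ((⊤ : ℕ∞) : WithTop ℕ∞) := WithTop.coe_le_coe.2 le_top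
    rw [iteratedFDeriv_const_smul_apply (hu.of_le h).contDiffAt, hu', smul_zero]

lemma polySub_eq_zero {n : ℕ} {V : Type*} [NormedAddCommGroup V] [InnerProductSpace ℝ V] (L : ℕ)
    (u : Euc n → V) (hu : ContDiff ℝ (⊤ : ℕ∞) u) (hL : ∀ x, iteratedFDeriv ℝ L u x = 0)
    (h0 : ∀ l < L, iteratedFDeriv ℝ l u 0 = 0) : u = 0 := by
  induction L with
  | zero =>
    funext x
    have := congrArg (fun c => c (fun _ => 0)) (hL x)
    simpa using this
  | succ L ih =>
    refine ih (fun x => ?_) (fun l hl => h0 l (by omega))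
    have hd : Differentiable ℝ (iteratedFDeriv ℝ L u) :=
      hu.differentiable_iteratedFDeriv (by exact_mod_cast WithTop.coe_lt_top L)
    have hf : ∀ y, fderiv ℝ (iteratedFDeriv ℝ L u) y = 0 := by
      intro y
      ext v m
      have h1 := congrArg (fun c => c (Fin.cons v m : Fin (L + 1) → Euc n)) (hL y)
      simp only [iteratedFDeriv_succ_apply_left] at h1
      simpa using h1
    rw [is_const_of_fderiv_eq_zero hd hf x 0]
    exact h0 L (by omega)

/-- The jet map. -/
def jet (n : ℕ) (V : Type*) [NormedAddCommGroup V] [InnerProductSpace ℝ V] (L : ℕ) :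
    polySub n V L →ₗ[ℝ] ((l : Fin L) → (Fin l → Fin n) → V) where
  toFun u l f := iteratedFDeriv ℝ l u.1 0 (fun i => eb (f i))
  map_add' := by
    rintro ⟨a, ha, ha'⟩ ⟨b, hb, hb'⟩
    funext l f
    have h : (((l : ℕ) : ℕ∞) : WithTop ℕ∞) ≤ ((⊤ : ℕ∞) : WithTop ℕ∞) := WithTop.coe_le_coe.2 le_top
    change iteratedFDeriv ℝ l (a + b) 0 _ = _
    rw [iteratedFDeriv_add_apply (ha.of_le h).contDiffAt (hb.of_le h).contDiffAt]
    rfl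
  map_smul' := by
    rintro c ⟨u, hu, hu'⟩
    funext l f
    have h : (((l : ℕ) : ℕ∞) : WithTop ℕ∞) ≤ ((⊤ : ℕ∞) : WithTop ℕ∞) := WithTop.coe_le_coe.2 le_top
    change iteratedFDeriv ℝ l (c • u) 0 _ = _
    rw [iteratedFDeriv_const_smul_apply (hu.of_le h).contDiffAt]
    rfl

lemma polySub_finite (L : ℕ) : FiniteDimensional ℝ (polySub n V L) := by
  refine FiniteDimensional.of_injective (jet n V L) ?_
  rw [← LinearMap.ker_eq_bot, LinearMap.ker_eq_bot']
  rintro ⟨u, hu, hu'⟩ h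
  apply Subtype.ext
  refine polySub_eq_zero L u hu hu' fun l hl => ?_
  rw [tensor_expand (iteratedFDeriv ℝ l u 0)]
  refine Finset.sum_eq_zero fun f _ => ?_
  have : iteratedFDeriv ℝ l u 0 (fun i => eb (f i)) = 0 :=
    congrFun (congrFun h ⟨l, hl⟩) f
  rw [this]
  ext m
  simp [dxT_apply]

lemma finite_of_cElliptic (A : OpCoeff n k V W) (hA : IsCElliptic A) :
    FiniteDimensional ℝ ↥(Submodule.span ℝ (nullSpace A)) := by
  obtain ⟨L, hL⟩ := exists_order A hA
  have := polySub_finite (n := n) (V := V) L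
  refine Submodule.finiteDimensional_of_le (S₂ := polySub n V L) ?_
  rw [Submodule.span_le]
  intro u hu
  exact ⟨hu.1, hL u hu⟩

/-- Exponential solutions: derivative formula. -/
lemma iter_exp {n : ℕ} (η₁ η₂ : Euc n) (c : ℂ) (k : ℕ) (x : Euc n) :
    iteratedFDeriv ℝ k (fun y : Euc n => Complex.exp (c *
      (((inner ℝ η₁ y : ℝ) : ℂ) + Complex.I * ((inner ℝ η₂ y : ℝ) : ℂ)))) x
    = (c ^ k * Complex.exp (c *
      (((inner ℝ η₁ x : ℝ) : ℂ) + Complex.I * ((inner ℝ η₂ x : ℝ) : ℂ)))) •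
        cxKernel n k η₁ η₂ := by
  set ζ : Euc n →L[ℝ] ℂ := Complex.ofRealCLM.comp (innerSL ℝ η₁)
    + Complex.I • Complex.ofRealCLM.comp (innerSL ℝ η₂) with hζ
  have hz : ∀ y, ((inner ℝ η₁ y : ℝ) : ℂ) + Complex.I * ((inner ℝ η₂ y : ℝ) : ℂ) = ζ y := by
    intro y; simp [hζ]
  have hk : ∀ (k : ℕ) m, cxKernel n k η₁ η₂ m = ∏ i, ζ (m i) := by
    intro k m
    rw [cxKernel_eb]
    simp only [hz]
  simp only [hz]
  induction k generalizing x with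
  | zero => ext m; simp [hk]
  | succ k ih =>
    ext m
    rw [iteratedFDeriv_succ_apply_left]
    have : iteratedFDeriv ℝ k (fun y : Euc n => Complex.exp (c * ζ y))
      = fun y => (c ^ k * Complex.exp (c * ζ y)) • cxKernel n k η₁ η₂ := funext fun y => ih y
    rw [this]
    have hd : HasFDerivAt (fun y : Euc n => c ^ k * Complex.exp (c * ζ y))
        ((c ^ k) • (Complex.exp (c * ζ x) • (c • ζ))) x := by
      exact ((ζ.hasFDerivAt.const_mul c).cexp).const_mul (c ^ k)
    rw [(hd.smul_const (cxKernel n k η₁ η₂)).fderiv]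
    simp only [ContinuousLinearMap.smulRight_apply, _root_.smul_apply,
      smul_eq_mul, hk, Fin.prod_univ_succ, Fin.tail]
    ring

/-- `z ↦ Re (z (v₁ + i v₂))`. -/
def reMul {V : Type*} [NormedAddCommGroup V] [InnerProductSpace ℝ V] (v₁ v₂ : V) : ℂ →L[ℝ] V :=
  Complex.reCLM.smulRight v₁ - Complex.imCLM.smulRight v₂

lemma not_finite_aux (A : OpCoeff n k V W) (η₁ η₂ : Euc n) (v₁ v₂ : V) (hη : (η₁, η₂) ≠ 0)
    (hre : A (cxSymTensorRe n k η₁ η₂ v₁ v₂) = 0) (him : A (cxSymTensorIm n k η₁ η₂ v₁ v₂) = 0)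
    (hv : v₁ ≠ 0) : ¬ FiniteDimensional ℝ ↥(Submodule.span ℝ (nullSpace A)) := by
  intro hfin
  obtain ⟨x₀, hx₀⟩ : ∃ x₀ : Euc n,
      ((inner ℝ η₁ x₀ : ℝ) : ℂ) + Complex.I * ((inner ℝ η₂ x₀ : ℝ) : ℂ) ≠ 0 := by
    by_contra hcon
    push Not at hcon
    apply hη
    have h1 : η₁ = 0 := by
      have := congrArg Complex.re (hcon η₁)
      rw [← inner_self_eq_zero (𝕜 := ℝ)]
      simpa only [Complex.add_re, Complex.ofReal_re, Complex.mul_re, Complex.I_re, Complex.I_im,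
        Complex.ofReal_im, zero_mul, mul_zero, sub_zero, add_zero, Complex.zero_re] using this
    have h2 : η₂ = 0 := by
      have := congrArg Complex.im (hcon η₂)
      rw [← inner_self_eq_zero (𝕜 := ℝ)]
      simpa only [Complex.add_im, Complex.ofReal_re, Complex.mul_im, Complex.I_re, Complex.I_im,
        Complex.ofReal_im, zero_mul, one_mul, zero_add, Complex.zero_im] using this
    rw [h1, h2]; rfl
  set z₀ := ((inner ℝ η₁ x₀ : ℝ) : ℂ) + Complex.I * ((inner ℝ η₂ x₀ : ℝ) : ℂ) with hz₀
  set F : ℕ → Euc n → V := fun j y => reMul v₁ v₂ (Complex.exp ((j / z₀) *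
      (((inner ℝ η₁ y : ℝ) : ℂ) + Complex.I * ((inner ℝ η₂ y : ℝ) : ℂ)))) with hF
  have hmem : ∀ j, F j ∈ nullSpace A := by
    intro j
    have hsm : ContDiff ℝ (⊤ : ℕ∞) (fun y : Euc n => Complex.exp (((j : ℂ) / z₀) *
      (((inner ℝ η₁ y : ℝ) : ℂ) + Complex.I * ((inner ℝ η₂ y : ℝ) : ℂ)))) := by
      apply ContDiff.cexp
      apply ContDiff.mul contDiff_const
      apply ContDiff.add
      · exact Complex.ofRealCLM.contDiff.comp (innerSL ℝ η₁).contDiff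
      · exact contDiff_const.mul (Complex.ofRealCLM.contDiff.comp (innerSL ℝ η₂).contDiff)
    refine ⟨(reMul v₁ v₂).contDiff.comp hsm, fun x => ?_⟩
    rw [opApply]
    have h1 := (reMul v₁ v₂).iteratedFDeriv_comp_left (hsm.contDiffAt (x := x)) (i := k)
      (WithTop.coe_le_coe.2 le_top)
    change A (iteratedFDeriv ℝ k (reMul v₁ v₂ ∘ (fun y : Euc n => Complex.exp (((j : ℂ) / z₀) *
      (((inner ℝ η₁ y : ℝ) : ℂ) + Complex.I * ((inner ℝ η₂ y : ℝ) : ℂ))))) x) = 0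
    rw [h1, iter_exp]
    set c := ((j : ℂ) / z₀) ^ k * Complex.exp (((j : ℂ) / z₀) *
      (((inner ℝ η₁ x : ℝ) : ℂ) + Complex.I * ((inner ℝ η₂ x : ℝ) : ℂ)))
    have h2 : (reMul v₁ v₂).compContinuousMultilinearMap (c • cxKernel n k η₁ η₂)
        = c.re • cxSymTensorRe n k η₁ η₂ v₁ v₂ - c.im • cxSymTensorIm n k η₁ η₂ v₁ v₂ := by
      ext m
      simp [reMul, cxSymTensorRe, cxSymTensorIm]
      module
    rw [h2, map_sub, map_smul, map_smul, hre, him]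
    simp
  -- linear independence
  let T : (Euc n → V) →ₗ[ℝ] (Multiplicative ℝ → ℝ) :=
    { toFun := fun u s => inner ℝ v₁ (u ((Multiplicative.toAdd s) • x₀)) / inner ℝ v₁ v₁
      map_add' := by intro a b; funext s; simp [inner_add_right, add_div]
      map_smul' := by intro a b; funext s; simp [inner_smul_right, mul_div_assoc] }
  let χ : ℕ → (Multiplicative ℝ →* ℝ) := fun j =>
    { toFun := fun s => Real.exp (j * Multiplicative.toAdd s)
      map_one' := by simp
      map_mul' := by intro a b; simp [mul_add, Real.exp_add] }
  have hχ : Function.Injective χ := by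
    intro a b h
    have := DFunLike.congr_fun h (Multiplicative.ofAdd 1)
    have h2 : Real.exp (a * 1) = Real.exp (b * 1) := this
    have := Real.exp_injective h2
    simpa using this
  have hT : ∀ j, T (F j) = (χ j : Multiplicative ℝ → ℝ) := by
    intro j
    funext s
    change inner ℝ v₁ (F j ((Multiplicative.toAdd s) • x₀)) / inner ℝ v₁ v₁
      = Real.exp (j * Multiplicative.toAdd s)
    set t := Multiplicative.toAdd s
    have e1 : (j / z₀) * (((inner ℝ η₁ (t • x₀) : ℝ) : ℂ)
        + Complex.I * ((inner ℝ η₂ (t • x₀) : ℝ) : ℂ)) = (((j * t : ℝ)) : ℂ) := by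
      have : (((inner ℝ η₁ (t • x₀) : ℝ) : ℂ)
        + Complex.I * ((inner ℝ η₂ (t • x₀) : ℝ) : ℂ)) = t * z₀ := by
        rw [hz₀, inner_smul_right, inner_smul_right]; push_cast; ring
      rw [this]
      push_cast
      field_simp
    have hv' : (inner ℝ v₁ v₁ : ℝ) ≠ 0 := inner_self_ne_zero.2 hv
    simp only [hF]
    rw [e1, ← Complex.ofReal_exp]
    simp only [reMul, _root_.sub_apply, ContinuousLinearMap.smulRight_apply,
      Complex.reCLM_apply, Complex.imCLM_apply, Complex.ofReal_re, Complex.ofReal_im, zero_smul,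
      sub_zero, inner_smul_right]
    field_simp
  have hli : LinearIndependent ℝ F := by
    apply LinearIndependent.of_comp T
    have := (linearIndependent_monoidHom (Multiplicative ℝ) ℝ).comp χ hχ
    have e : (T ∘ F) = ((fun f : Multiplicative ℝ →* ℝ => (f : Multiplicative ℝ → ℝ)) ∘ χ) :=
      funext hT
    rw [e]
    exact this
  have hli2 : LinearIndependent ℝ
      (fun j => (⟨F j, Submodule.subset_span (hmem j)⟩ : Submodule.span ℝ (nullSpace A))) := by
    apply LinearIndependent.of_comp (Submodule.span ℝ (nullSpace A)).subtype
    exact hli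
  have := hli2.finite
  exact not_finite ℕ

end Helpers

/-- The null-space `{u ∈ C^∞(ℝⁿ, V) : 𝔸u = 0}` is a finite-dimensional
real vector space if and only if `𝔸` is ℂ-elliptic. -/
theorem statement4 (hn : 1 < n) (A : OpCoeff n k V W) :
    FiniteDimensional ℝ ↥(Submodule.span ℝ (nullSpace A)) ↔ IsCElliptic A := by
  refine ⟨fun hfin => ?_, finite_of_cElliptic A⟩
  intro η₁ η₂ v₁ v₂ hη hre him
  by_contra hcon
  by_cases h1 : v₁ = 0
  · have h2 : v₂ ≠ 0 := fun h => hcon ⟨h1, h⟩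
    refine not_finite_aux A η₁ η₂ v₂ (-v₁) hη ?_ ?_ h2 hfin
    · have : cxSymTensorRe n k η₁ η₂ v₂ (-v₁) = cxSymTensorIm n k η₁ η₂ v₁ v₂ := by
        ext m
        simp [cxSymTensorRe, cxSymTensorIm]
        module
      rw [this, him]
    · have : cxSymTensorIm n k η₁ η₂ v₂ (-v₁) = - cxSymTensorRe n k η₁ η₂ v₁ v₂ := by
        ext m
        simp [cxSymTensorRe, cxSymTensorIm]
        module
      rw [this, map_neg, hre, neg_zero]
  · exact not_finite_aux A η₁ η₂ v₁ v₂ hη hre him h1 hfin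
end
end

section
/- Let n ≥ 3 and N ≥ 2, and consider the first-order operator 𝔸 acting on u : ℝⁿ → ℝ^N whose components are ∂₁u₁ − ∂₂u₂, ∂₂u₁ + ∂₁u₂, together with ∂_j u_i for all pairs (i,j) ∈ {1,…,N}×{1,…,n} with (i,j) ∉ {1,2}×{1,2}. Then: (i) 𝔸 is elliptic, i.e. its symbol 𝔸[ξ] is injective on ℝ^N for every ξ ∈ ℝⁿ\{0}; (ii) 𝔸 is cancelling, i.e. the intersection over ξ ∈ ℝⁿ\{0} of the images 𝔸[ξ](ℝ^N) is {0}; and (iii) the space { u ∈ C^∞(ℝⁿ, ℝ^N) : 𝔸u = 0 } is infinite-dimensional. -/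
noncomputable section

open MeasureTheory Metric

/-- Index type for the components of the operator `𝔸 = 𝔸_{1,n}`: the two special
components `∂₁u₁ − ∂₂u₂` and `∂₂u₁ + ∂₁u₂`, together with one component `∂_j u_i` for
each pair `(i,j) ∉ {1,2} × {1,2}` (zero-based: `(i,j) ∉ {0,1} × {0,1}`). -/
abbrev AIdx (n N : ℕ) : Type :=
  Fin 2 ⊕ {p : Fin N × Fin n // ¬(p.1.1 < 2 ∧ p.2.1 < 2)}

/-- The symbol `𝔸[ξ] v` of the operator `𝔸_{1,n}`. -/
def Asymb (n N : ℕ) (hn : 3 ≤ n) (hN : 2 ≤ N) (ξ : Euc n)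
    (v : EuclideanSpace ℝ (Fin N)) : AIdx n N → ℝ
  | Sum.inl i =>
      if i = 0 then ξ ⟨0, by omega⟩ * v ⟨0, by omega⟩ - ξ ⟨1, by omega⟩ * v ⟨1, by omega⟩
      else ξ ⟨1, by omega⟩ * v ⟨0, by omega⟩ + ξ ⟨0, by omega⟩ * v ⟨1, by omega⟩
  | Sum.inr p => ξ p.1.2 * v p.1.1

/-- The operator `𝔸_{1,n}` itself: components `∂₁u₁ − ∂₂u₂`, `∂₂u₁ + ∂₁u₂` and `∂_j u_i`
for `(i,j) ∉ {1,2} × {1,2}`. -/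
def Aop (n N : ℕ) (hn : 3 ≤ n) (hN : 2 ≤ N) (u : Euc n → EuclideanSpace ℝ (Fin N))
    (x : Euc n) : AIdx n N → ℝ
  | Sum.inl i =>
      if i = 0 then
        fderiv ℝ u x (EuclideanSpace.single ⟨0, by omega⟩ 1) ⟨0, by omega⟩
          - fderiv ℝ u x (EuclideanSpace.single ⟨1, by omega⟩ 1) ⟨1, by omega⟩
      else
        fderiv ℝ u x (EuclideanSpace.single ⟨1, by omega⟩ 1) ⟨0, by omega⟩
          + fderiv ℝ u x (EuclideanSpace.single ⟨0, by omega⟩ 1) ⟨1, by omega⟩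
  | Sum.inr p => fderiv ℝ u x (EuclideanSpace.single p.1.2 1) p.1.1

/-- Projection `x ↦ x₁ + i x₂`. -/
def auxPi (n : ℕ) (hn : 3 ≤ n) : Euc n →L[ℝ] ℂ :=
  (EuclideanSpace.proj (⟨0, by omega⟩ : Fin n) : Euc n →L[ℝ] ℝ).smulRight (1 : ℂ) +
  (EuclideanSpace.proj (⟨1, by omega⟩ : Fin n) : Euc n →L[ℝ] ℝ).smulRight Complex.I

/-- Embedding `z ↦ (Re z, Im z, 0, …, 0)`. -/
def auxJ (N : ℕ) (hN : 2 ≤ N) : ℂ →L[ℝ] EuclideanSpace ℝ (Fin N) :=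
  Complex.reCLM.smulRight (EuclideanSpace.single (⟨0, by omega⟩ : Fin N) (1 : ℝ)) +
  Complex.imCLM.smulRight (EuclideanSpace.single (⟨1, by omega⟩ : Fin N) (1 : ℝ))

theorem auxPi_apply (n : ℕ) (hn : 3 ≤ n) (x : Euc n) :
    auxPi n hn x = (x ⟨0, by omega⟩ : ℂ) + (x ⟨1, by omega⟩ : ℂ) * Complex.I := by
  simp [auxPi]

theorem auxJ_zero (N : ℕ) (hN : 2 ≤ N) (z : ℂ) : auxJ N hN z ⟨0, by omega⟩ = z.re := by
  simp [auxJ]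

theorem auxJ_one (N : ℕ) (hN : 2 ≤ N) (z : ℂ) : auxJ N hN z ⟨1, by omega⟩ = z.im := by
  simp [auxJ]

theorem auxJ_ge (N : ℕ) (hN : 2 ≤ N) (z : ℂ) (i : Fin N) (hi : 2 ≤ i.1) :
    auxJ N hN z i = 0 := by
  have h0 : i ≠ ⟨0, by omega⟩ := by intro h; rw [h] at hi; simp at hi
  have h1 : i ≠ ⟨1, by omega⟩ := by intro h; rw [h] at hi; simp at hi
  simp [auxJ, h0, h1]

theorem auxPi_e0 (n : ℕ) (hn : 3 ≤ n) :
    auxPi n hn (EuclideanSpace.single ⟨0, by omega⟩ 1) = 1 := by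
  simp [auxPi_apply]

theorem auxPi_e1 (n : ℕ) (hn : 3 ≤ n) :
    auxPi n hn (EuclideanSpace.single ⟨1, by omega⟩ 1) = Complex.I := by
  simp [auxPi_apply]

theorem auxPi_ge (n : ℕ) (hn : 3 ≤ n) (j : Fin n) (hj : 2 ≤ j.1) :
    auxPi n hn (EuclideanSpace.single j 1) = 0 := by
  have h0 : (⟨0, by omega⟩ : Fin n) ≠ j := by intro h; rw [← h] at hj; simp at hj
  have h1 : (⟨1, by omega⟩ : Fin n) ≠ j := by intro h; rw [← h] at hj; simp at hj
  simp [auxPi_apply, h0, h1]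

/-- Polynomial null-space elements. -/
def auxU (n N : ℕ) (hn : 3 ≤ n) (hN : 2 ≤ N) :
    Polynomial ℝ →ₗ[ℝ] (Euc n → EuclideanSpace ℝ (Fin N)) where
  toFun p := fun x => auxJ N hN (Polynomial.aeval (auxPi n hn x) p)
  map_add' p q := by ext1 x; simp
  map_smul' c p := by
    ext1 x
    simp only [map_smul, Pi.smul_apply, RingHom.id_apply]

theorem auxU_fderiv (n N : ℕ) (hn : 3 ≤ n) (hN : 2 ≤ N) (p : Polynomial ℝ) (x h : Euc n) :
    fderiv ℝ (auxU n N hn hN p) x h =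
      auxJ N hN (auxPi n hn h * Polynomial.aeval (auxPi n hn x) (Polynomial.derivative p)) := by
  have h1 : HasFDerivAt (fun z : ℂ => Polynomial.aeval z p) _ (auxPi n hn x) :=
    (p.hasDerivAt_aeval (auxPi n hn x)).hasFDerivAt.restrictScalars ℝ
  have h2 := (auxJ N hN).hasFDerivAt.comp x (h1.comp x (auxPi n hn).hasFDerivAt)
  have h3 : HasFDerivAt (auxU n N hn hN p) _ x := h2
  rw [h3.fderiv]
  simp

theorem auxU_mem (n N : ℕ) (hn : 3 ≤ n) (hN : 2 ≤ N) (p : Polynomial ℝ) :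
    ContDiff ℝ (⊤ : ℕ∞) (auxU n N hn hN p) ∧
      ∀ x, Aop n N hn hN (auxU n N hn hN p) x = 0 := by
  constructor
  · have h1 : ContDiff ℝ (⊤ : ℕ∞) (fun z : ℂ => Polynomial.aeval z p) := by
      have h0 : ContDiff ℂ (⊤ : ℕ∞) (fun z : ℂ =>
          Polynomial.aeval z (p.map (algebraMap ℝ ℂ))) := Polynomial.contDiff_aeval _ _
      simp only [Polynomial.aeval_map_algebraMap] at h0
      exact h0.restrict_scalars ℝ
    exact (auxJ N hN).contDiff.comp (h1.comp (auxPi n hn).contDiff)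
  · intro x
    funext k
    rcases k with i | ⟨⟨i, j⟩, hij⟩
    · by_cases hi : i = 0
      · simp [Aop, hi, auxU_fderiv, auxPi_e0, auxPi_e1, auxJ_zero, auxJ_one]
      · simp [Aop, hi, auxU_fderiv, auxPi_e0, auxPi_e1, auxJ_zero, auxJ_one]
    · simp only [Aop, auxU_fderiv, Pi.zero_apply]
      by_cases hj : j.1 < 2
      · exact auxJ_ge N hN _ i (by simp at hij; omega)
      · rw [auxPi_ge n hn j (by omega)]; simp

theorem auxU_injective (n N : ℕ) (hn : 3 ≤ n) (hN : 2 ≤ N) :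
    Function.Injective (auxU n N hn hN) := by
  rw [← LinearMap.ker_eq_bot, LinearMap.ker_eq_bot']
  intro p hp
  apply Polynomial.funext
  intro t
  have h := congrArg (fun v => v ⟨0, by omega⟩)
    (congrFun hp (EuclideanSpace.single ⟨0, by omega⟩ t))
  have h2 : auxPi n hn (EuclideanSpace.single ⟨0, by omega⟩ t) = algebraMap ℝ ℂ t := by
    simp [auxPi_apply]
  simp only [auxU, LinearMap.coe_mk, AddHom.coe_mk, h2, auxJ_zero,
    Polynomial.aeval_algebraMap_apply] at h
  simpa using h

theorem aux_elliptic (n N : ℕ) (hn : 3 ≤ n) (hN : 2 ≤ N) (ξ : Euc n) (hξ : ξ ≠ 0) :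
    Function.Injective (Asymb n N hn hN ξ) := by
  intro v w h
  have hr : ∀ (i : Fin N) (j : Fin n), ¬(i.1 < 2 ∧ j.1 < 2) → ξ j ≠ 0 → v i = w i := by
    intro i j hij hj
    have := congrFun h (Sum.inr ⟨(i, j), hij⟩)
    simp only [Asymb] at this
    exact mul_left_cancel₀ hj this
  obtain ⟨j, hj⟩ : ∃ j, ξ j ≠ 0 := by
    by_contra! hc
    exact hξ (by ext j; simpa using hc j)
  ext i
  by_cases hij : i.1 < 2 ∧ j.1 < 2
  · have e0 := congrFun h (Sum.inl 0)
    have e1 := congrFun h (Sum.inl 1)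
    simp only [Asymb, if_true, one_ne_zero, if_false] at e0 e1
    have hpos : 0 < ξ ⟨0, by omega⟩ ^ 2 + ξ ⟨1, by omega⟩ ^ 2 := by
      obtain ⟨j, hjn⟩ := j
      have : j = 0 ∨ j = 1 := by simp at hij; omega
      rcases this with rfl | rfl <;> positivity
    obtain ⟨i, hiN⟩ := i
    have : i = 0 ∨ i = 1 := by simp at hij; omega
    rcases this with rfl | rfl
    · apply mul_left_cancel₀ hpos.ne'
      linear_combination ξ ⟨0, by omega⟩ * e0 + ξ ⟨1, by omega⟩ * e1
    · apply mul_left_cancel₀ hpos.ne'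
      linear_combination ξ ⟨0, by omega⟩ * e1 - ξ ⟨1, by omega⟩ * e0
  · exact hr i j hij hj

theorem aux_cancelling (n N : ℕ) (hn : 3 ≤ n) (hN : 2 ≤ N) :
    (⋂ ξ ∈ {ξ : Euc n | ξ ≠ 0}, Set.range (Asymb n N hn hN ξ)) = {0} := by
  ext w
  simp only [Set.mem_iInter, Set.mem_singleton_iff, Set.mem_ofPred_eq]
  constructor
  · intro hw
    obtain ⟨v, hv⟩ := hw (EuclideanSpace.single ⟨2, by omega⟩ 1) (by simp)
    obtain ⟨v', hv'⟩ := hw (EuclideanSpace.single ⟨0, by omega⟩ 1) (by simp)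
    funext k
    rcases k with i | ⟨⟨i, j⟩, hij⟩
    · rw [← hv]
      by_cases hi : i = 0 <;> simp [Asymb, hi]
    · by_cases hj : j = ⟨2, by omega⟩
      · rw [← hv']
        simp [Asymb, hj]
      · rw [← hv]
        simp [Asymb, hj]
  · rintro rfl ξ _
    refine ⟨0, ?_⟩
    funext k
    rcases k with i | p
    · by_cases hi : i = 0 <;> simp [Asymb, hi]
    · simp [Asymb]

/-- For `n ≥ 3`, `N ≥ 2`, the operator `𝔸_{1,n}` is (i) elliptic,
(ii) cancelling, and (iii) has infinite-dimensional null-space. -/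
theorem statement7 (n N : ℕ) (hn : 3 ≤ n) (hN : 2 ≤ N) :
    (∀ ξ : Euc n, ξ ≠ 0 → Function.Injective (Asymb n N hn hN ξ)) ∧
    (⋂ ξ ∈ {ξ : Euc n | ξ ≠ 0}, Set.range (Asymb n N hn hN ξ)) = {0} ∧
    ¬ FiniteDimensional ℝ ↥(Submodule.span ℝ
        {u : Euc n → EuclideanSpace ℝ (Fin N) |
          ContDiff ℝ (⊤ : ℕ∞) u ∧ ∀ x, Aop n N hn hN u x = 0}) := by
  refine ⟨aux_elliptic n N hn hN, aux_cancelling n N hn hN, ?_⟩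
  intro hfin
  have hinj : Function.Injective ((auxU n N hn hN).codRestrict (Submodule.span ℝ
        {u : Euc n → EuclideanSpace ℝ (Fin N) |
          ContDiff ℝ (⊤ : ℕ∞) u ∧ ∀ x, Aop n N hn hN u x = 0})
      (fun p => Submodule.subset_span (auxU_mem n N hn hN p))) := by
    intro p q hpq
    exact auxU_injective n N hn hN (congrArg Subtype.val hpq)
  exact Polynomial.not_finite (R := ℝ) (Module.Finite.of_injective _ hinj)
end
end

section
/- Let n = 2, V = ℝ, and let 𝔸 be a second-order (k=2) homogeneous linear constant-coefficient differential operator on ℝ² from ℝ to W. Suppose 𝔸 is elliptic (𝔸[ξ] injective for all real ξ ≠ 0) but not ℂ-elliptic (there is ξ ∈ ℂ²\{0} with 𝔸[ξ] not injective on ℂ). Then 𝔸 is not cancelling; in fact there is a nonzero w₀ ∈ W with 𝔸[ξ](ℝ) = ℝ·w₀ for every ξ ∈ ℝ²\{0}, so ⋂_{ξ ∈ ℝ²\{0}} 𝔸[ξ](ℝ) ≠ {0}. -/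
noncomputable section

open MeasureTheory Metric
open scoped ENNReal RealInnerProductSpace

variable {n k : ℕ} {V W : Type*}
  [NormedAddCommGroup V] [InnerProductSpace ℝ V] [FiniteDimensional ℝ V]
  [NormedAddCommGroup W] [InnerProductSpace ℝ W] [FiniteDimensional ℝ W]

lemma symTensor_comb (η₁ η₂ : Euc 2) (a b : ℝ) :
    symTensor 2 2 (a • η₁ + b • η₂) (1:ℝ) = a ^ 2 • symTensor 2 2 η₁ (1:ℝ)
      + b ^ 2 • symTensor 2 2 η₂ (1:ℝ) + (a * b) • cxSymTensorIm 2 2 η₁ η₂ (1:ℝ) 0 := by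
  ext m
  simp [symTensor, cxSymTensorIm, cxKernel, Fin.prod_univ_two, inner_add_left, inner_smul_left]
  ring

lemma cxRe_eq (η₁ η₂ : Euc 2) (v₁ v₂ : ℝ) :
    cxSymTensorRe 2 2 η₁ η₂ v₁ v₂ = v₁ • (symTensor 2 2 η₁ (1:ℝ) - symTensor 2 2 η₂ (1:ℝ))
      - v₂ • cxSymTensorIm 2 2 η₁ η₂ (1:ℝ) 0 := by
  ext m
  simp [symTensor, cxSymTensorRe, cxSymTensorIm, cxKernel, Fin.prod_univ_two]
  ring

lemma cxIm_eq (η₁ η₂ : Euc 2) (v₁ v₂ : ℝ) :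
    cxSymTensorIm 2 2 η₁ η₂ v₁ v₂ = v₂ • (symTensor 2 2 η₁ (1:ℝ) - symTensor 2 2 η₂ (1:ℝ))
      + v₁ • cxSymTensorIm 2 2 η₁ η₂ (1:ℝ) 0 := by
  ext m
  simp [symTensor, cxSymTensorIm, cxKernel, Fin.prod_univ_two]
  ring

lemma symTensor_smul_one (ξ : Euc 2) (v : ℝ) :
    symTensor 2 2 ξ v = v • symTensor 2 2 ξ (1:ℝ) := by
  ext m
  simp [symTensor, Fin.prod_univ_two]
  ring

/-- (`n = 2`, `V = ℝ`, `k = 2`.) If a second-order scalar operator on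
`ℝ²` is elliptic but not ℂ-elliptic, then there is a nonzero `w₀ ∈ W` with
`𝔸[ξ](ℝ) = ℝ • w₀` for every real `ξ ≠ 0`; in particular `𝔸` is not cancelling. -/
theorem statement9 (A : OpCoeff 2 2 ℝ W) (hE : IsElliptic A) (hNC : ¬ IsCElliptic A) :
    (∃ w₀ : W, w₀ ≠ 0 ∧ ∀ ξ : Euc 2, ξ ≠ 0 →
      Set.range (symbol A ξ) = Set.range (fun t : ℝ => t • w₀)) ∧
    ¬ IsCancelling A := by
  have hsym : ∀ ξ v, symbol A ξ v = v • A (symTensor 2 2 ξ (1:ℝ)) := fun ξ v => by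
    rw [symbol, symTensor_smul_one, map_smul]
  have hne : ∀ ξ : Euc 2, ξ ≠ 0 → A (symTensor 2 2 ξ (1:ℝ)) ≠ 0 := by
    intro ξ hξ h0
    have := hE ξ hξ (a₁ := 1) (a₂ := 0) (by rw [hsym, hsym, h0]; simp)
    exact one_ne_zero this
  have key : ∃ w₀ : W, w₀ ≠ 0 ∧ ∀ ξ : Euc 2, ξ ≠ 0 →
      Set.range (symbol A ξ) = Set.range (fun t : ℝ => t • w₀) := by
    unfold IsCElliptic at hNC
    push Not at hNC
    obtain ⟨η₁, η₂, v₁, v₂, hη, h1, h2, hv⟩ := hNC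
    rw [cxRe_eq, map_sub, map_smul, map_smul, map_sub] at h1
    rw [cxIm_eq, map_add, map_smul, map_smul, map_sub] at h2
    have hcomb : ∀ a b : ℝ, A (symTensor 2 2 (a • η₁ + b • η₂) (1:ℝ)) =
        a ^ 2 • A (symTensor 2 2 η₁ (1:ℝ)) + b ^ 2 • A (symTensor 2 2 η₂ (1:ℝ))
        + (a * b) • A (cxSymTensorIm 2 2 η₁ η₂ (1:ℝ) 0) := fun a b => by
      rw [symTensor_comb, map_add, map_add, map_smul, map_smul, map_smul]
    have hn1 := hne η₁
    have hn2 := hne η₂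
    generalize A (symTensor 2 2 η₁ (1:ℝ)) = p at *
    generalize A (symTensor 2 2 η₂ (1:ℝ)) = q at *
    generalize A (cxSymTensorIm 2 2 η₁ η₂ (1:ℝ) 0) = y at *
    have hvv : v₁ ^ 2 + v₂ ^ 2 ≠ 0 := by
      intro h
      have e1 : v₁ = 0 := by nlinarith [sq_nonneg v₁, sq_nonneg v₂]
      have e2 : v₂ = 0 := by nlinarith [sq_nonneg v₁, sq_nonneg v₂]
      exact hv e1 e2
    have hx : (v₁ ^ 2 + v₂ ^ 2) • (p - q) = 0 := by
      have : (v₁ ^ 2 + v₂ ^ 2) • (p - q) =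
        v₁ • (v₁ • (p - q) - v₂ • y) + v₂ • (v₂ • (p - q) + v₁ • y) := by module
      rw [this, h1, h2]; simp
    have hy : (v₁ ^ 2 + v₂ ^ 2) • y = 0 := by
      have : (v₁ ^ 2 + v₂ ^ 2) • y =
        v₁ • (v₂ • (p - q) + v₁ • y) - v₂ • (v₁ • (p - q) - v₂ • y) := by module
      rw [this, h1, h2]; simp
    have hpq : p = q := sub_eq_zero.mp ((smul_eq_zero.mp hx).resolve_left hvv)
    have hy0 : y = 0 := (smul_eq_zero.mp hy).resolve_left hvv
    subst hpq hy0
    have hp : p ≠ 0 := by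
      by_cases h : η₁ = 0
      · exact hn2 fun h' => hη (by rw [h, h']; rfl)
      · exact hn1 h
    have hcomb' : ∀ a b : ℝ, A (symTensor 2 2 (a • η₁ + b • η₂) (1:ℝ)) = (a ^ 2 + b ^ 2) • p :=
      fun a b => by rw [hcomb]; module
    have hzero : A (symTensor 2 2 0 (1:ℝ)) = 0 := by
      simpa using hcomb' 0 0
    have hli : LinearIndependent ℝ ![η₁, η₂] := by
      rw [LinearIndependent.pair_iff]
      intro a b hab
      have h := hcomb' a b
      rw [hab, hzero] at h
      have h := (smul_eq_zero.mp h.symm).resolve_right hp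
      constructor <;> nlinarith [sq_nonneg a, sq_nonneg b]
    have hspan := hli.span_eq_top_of_card_eq_finrank (by simp)
    refine ⟨p, hp, fun ξ hξ => ?_⟩
    have hm : ξ ∈ Submodule.span ℝ (Set.range ![η₁, η₂]) := by rw [hspan]; trivial
    rw [Matrix.range_cons, Matrix.range_cons, Matrix.range_empty, Set.union_empty,
      Set.singleton_union, Submodule.mem_span_pair] at hm
    obtain ⟨a, b, rfl⟩ := hm
    have hc := hne _ hξ
    rw [hcomb'] at hc
    have hc : a ^ 2 + b ^ 2 ≠ 0 := fun h => hc (by rw [h, zero_smul])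
    ext w
    constructor
    · rintro ⟨v, rfl⟩
      exact ⟨v * (a ^ 2 + b ^ 2), by simp only [hsym, hcomb', mul_smul]⟩
    · rintro ⟨t, rfl⟩
      exact ⟨t / (a ^ 2 + b ^ 2), by simp only [hsym, hcomb', smul_smul, div_mul_cancel₀ _ hc]⟩
  refine ⟨key, fun hcan => ?_⟩
  obtain ⟨w, hw, hr⟩ := key
  have : w ∈ (⋂ ξ ∈ {ξ : Euc 2 | ξ ≠ 0}, Set.range (symbol A ξ)) := by
    simp only [Set.mem_iInter]
    intro ξ hξ
    rw [hr ξ hξ]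
    exact ⟨1, one_smul _ _⟩
  rw [hcan] at this
  exact hw this
end
end

section
/- Let n = 2 and let 𝔸 be a first-order (k=1) homogeneous linear constant-coefficient differential operator on ℝ² from V to W. If 𝔸 is elliptic but not cancelling, then the subspace ⋂_{ζ ∈ ℝ²\{0}} 𝔸[ζ](V) of W has dimension at least 2. -/
noncomputable section

open MeasureTheory Metric
open scoped ENNReal RealInnerProductSpace

variable {n k : ℕ} {V W : Type*}
  [NormedAddCommGroup V] [InnerProductSpace ℝ V] [FiniteDimensional ℝ V]
  [NormedAddCommGroup W] [InnerProductSpace ℝ W] [FiniteDimensional ℝ W]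

/-- For `t → 0` the ranges of `L + t M` can only accumulate in the range of the injective `L`. -/
theorem mem_range_of_pencil {V W : Type*}
    [NormedAddCommGroup V] [InnerProductSpace ℝ V] [FiniteDimensional ℝ V]
    [NormedAddCommGroup W] [InnerProductSpace ℝ W] [FiniteDimensional ℝ W]
    (L M : V →ₗ[ℝ] W) (hL : Function.Injective L) (x : W)
    (hx : ∀ t : ℝ, t ≠ 0 → ∃ v, L v + t • M v = x) : x ∈ LinearMap.range L := by
  obtain ⟨K, hK, hanti⟩ := L.exists_antilipschitzWith (LinearMap.ker_eq_bot.mpr hL)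
  have hb : ∀ v, ‖v‖ ≤ K * ‖L v‖ := fun v => by
    simpa using hanti.le_mul_dist v 0
  set m : ℝ := ‖LinearMap.toContinuousLinearMap M‖ with hm
  have hm0 : 0 ≤ m := norm_nonneg _
  have hM : ∀ v, ‖M v‖ ≤ m * ‖v‖ := fun v => (LinearMap.toContinuousLinearMap M).le_opNorm v
  have hK0 : (0 : ℝ) < K := by exact_mod_cast hK
  have hcl : IsClosed (LinearMap.range L : Set W) := Submodule.closed_of_finiteDimensional _
  rw [← SetLike.mem_coe, ← hcl.closure_eq, Metric.mem_closure_iff]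
  intro ε hε
  obtain ⟨t, ht0, ht1, ht2⟩ : ∃ t : ℝ, 0 < t ∧ K * (t * m) ≤ 1 / 2 ∧
      t * (m * (2 * K * ‖x‖)) < ε := by
    have h1 : 0 < 2 * (K * m + 1) := by positivity
    have h2 : 0 < m * (2 * K * ‖x‖) + 1 := by positivity
    refine ⟨min (1 / (2 * (K * m + 1))) (ε / (m * (2 * K * ‖x‖) + 1)), by positivity, ?_, ?_⟩
    · have h := min_le_left (1 / (2 * (K * m + 1))) (ε / (m * (2 * K * ‖x‖) + 1))
      rw [le_div_iff₀ h1] at h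
      have : 0 < min (1 / (2 * (K * m + 1))) (ε / (m * (2 * K * ‖x‖) + 1)) := by positivity
      nlinarith
    · have h := min_le_right (1 / (2 * (K * m + 1))) (ε / (m * (2 * K * ‖x‖) + 1))
      rw [le_div_iff₀ h2] at h
      have : 0 < min (1 / (2 * (K * m + 1))) (ε / (m * (2 * K * ‖x‖) + 1)) := by positivity
      nlinarith
  obtain ⟨v, hv⟩ := hx t ht0.ne'
  have htM : ‖t • M v‖ ≤ t * (m * ‖v‖) := by
    rw [norm_smul, Real.norm_of_nonneg ht0.le]
    exact mul_le_mul_of_nonneg_left (hM v) ht0.le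
  have hLv : ‖L v‖ ≤ ‖x‖ + t * (m * ‖v‖) := by
    have : L v = x - t • M v := by rw [← hv]; abel
    rw [this]
    exact (norm_sub_le _ _).trans (by linarith)
  have hvb : ‖v‖ ≤ 2 * K * ‖x‖ := by
    have h1 := (hb v).trans (mul_le_mul_of_nonneg_left hLv hK0.le)
    have h2 := mul_le_mul_of_nonneg_right ht1 (norm_nonneg v)
    nlinarith
  refine ⟨L v, ⟨v, rfl⟩, ?_⟩
  have : x - L v = t • M v := by rw [← hv]; abel
  rw [dist_eq_norm, this]
  have h3 : t * (m * ‖v‖) ≤ t * (m * (2 * K * ‖x‖)) := by gcongr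
  linarith

/-- The symbol at a fixed frequency as a linear map (first order case). -/
def symbolLin {V W : Type*}
    [NormedAddCommGroup V] [InnerProductSpace ℝ V] [FiniteDimensional ℝ V]
    [NormedAddCommGroup W] [InnerProductSpace ℝ W] [FiniteDimensional ℝ W]
    (A : OpCoeff 2 1 V W) (ξ : Euc 2) : V →ₗ[ℝ] W where
  toFun := symbol A ξ
  map_add' u v := by
    unfold symbol
    rw [← map_add]
    congr 1
    ext m
    simp [symTensor]
  map_smul' c v := by
    unfold symbol
    rw [RingHom.id_apply, ← map_smul]
    congr 1
    ext m
    simp [symTensor, smul_smul, mul_comm]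

theorem symbol_eq_pencil {V W : Type*}
    [NormedAddCommGroup V] [InnerProductSpace ℝ V] [FiniteDimensional ℝ V]
    [NormedAddCommGroup W] [InnerProductSpace ℝ W] [FiniteDimensional ℝ W]
    (A : OpCoeff 2 1 V W) (ξ : Euc 2) (v : V) :
    symbol A ξ v = ξ 0 • symbolLin A (!₂[1, 0]) v + ξ 1 • symbolLin A (!₂[0, 1]) v := by
  change symbol A ξ v = ξ 0 • symbol A (!₂[1, 0]) v + ξ 1 • symbol A (!₂[0, 1]) v
  unfold symbol
  rw [← map_smul, ← map_smul, ← map_add]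
  congr 1
  ext m
  simp [symTensor, PiLp.inner_apply, Fin.sum_univ_two, smul_smul, add_smul, mul_comm]

/-- (`n = 2`, `k = 1`.) If a first-order operator on `ℝ²` is elliptic
but not cancelling, then the subspace `⋂_{ζ ≠ 0} 𝔸[ζ](V)` of `W` has dimension ≥ 2. -/
theorem statement11 (A : OpCoeff 2 1 V W) (hE : IsElliptic A) (hNC : ¬ IsCancelling A) :
    2 ≤ Set.finrank ℝ (⋂ ξ ∈ {ξ : Euc 2 | ξ ≠ 0}, Set.range (symbol A ξ)) := by
  set S : Set W := ⋂ ξ ∈ {ξ : Euc 2 | ξ ≠ 0}, Set.range (symbol A ξ) with hS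
  have hmem : ∀ w, w ∈ S ↔ ∀ ξ : Euc 2, ξ ≠ 0 → ∃ v, symbol A ξ v = w := by
    intro w
    simp [hS]
  have h0 : (0 : W) ∈ S := (hmem 0).2 fun ξ _ => ⟨0, (symbolLin A ξ).map_zero⟩
  obtain ⟨w, hw, hw0⟩ : ∃ w ∈ S, w ≠ 0 := by
    by_contra! h
    exact hNC (Set.eq_singleton_iff_unique_mem.2 ⟨h0, h⟩)
  set L := symbolLin A (!₂[1, 0]) with hLdef
  set M := symbolLin A (!₂[0, 1]) with hMdef
  have hsym : ∀ ξ v, symbol A ξ v = ξ 0 • L v + ξ 1 • M v := symbol_eq_pencil A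
  have hne : ∀ ξ : Euc 2, ξ 0 ≠ 0 ∨ ξ 1 ≠ 0 → ξ ≠ 0 := by
    rintro ξ h rfl
    simp at h
  have hL : Function.Injective L := hE _ (hne _ (by simp))
  obtain ⟨v, hv⟩ := (hmem w).1 hw (!₂[1, 0]) (hne _ (by simp))
  replace hv : L v = w := hv
  have hkey : ∀ ξ : Euc 2, ξ 1 ≠ 0 → ∃ u, symbol A ξ u = M v := by
    intro ξ hξ
    obtain ⟨u, hu⟩ := (hmem w).1 hw ξ (hne _ (Or.inr hξ))
    refine ⟨(ξ 1)⁻¹ • (v - ξ 0 • u), ?_⟩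
    have e : symbol A ξ ((ξ 1)⁻¹ • (v - ξ 0 • u))
        = (ξ 1)⁻¹ • (symbol A ξ v - ξ 0 • symbol A ξ u) := by
      change symbolLin A ξ _ = (ξ 1)⁻¹ • (symbolLin A ξ v - ξ 0 • symbolLin A ξ u)
      rw [map_smul, map_sub, map_smul]
    rw [e, hu, hsym ξ v, hv, add_sub_cancel_left, smul_smul, inv_mul_cancel₀ hξ, one_smul]
  have hMS : M v ∈ S := by
    rw [hmem]
    intro ξ hξ
    by_cases h1 : ξ 1 = 0
    · have hξ0 : ξ 0 ≠ 0 := by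
        intro h
        apply hξ
        ext i
        fin_cases i <;> simp [h, h1]
      obtain ⟨u, hu⟩ := mem_range_of_pencil L M hL (M v) (by
        intro t ht
        obtain ⟨u, hu⟩ := hkey (!₂[1, t]) (by simpa using ht)
        refine ⟨u, ?_⟩
        rw [hsym] at hu
        simpa using hu)
      refine ⟨(ξ 0)⁻¹ • u, ?_⟩
      rw [hsym, h1, zero_smul, add_zero, map_smul, smul_smul, mul_inv_cancel₀ hξ0, one_smul, hu]
    · exact hkey ξ h1
  have hli : LinearIndependent ℝ ![w, M v] := by
    rw [LinearIndependent.pair_iff]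
    intro s t hst
    by_contra hcon
    have hξ : (!₂[s, t] : Euc 2) ≠ 0 := by
      apply hne
      by_contra! h
      exact hcon (by simpa using h)
    have hv0 : v = 0 := by
      apply hE _ hξ
      have z : symbol A (!₂[s, t]) 0 = 0 := (symbolLin A _).map_zero
      rw [z, hsym]
      simpa [hv] using hst
    exact hw0 (by rw [← hv, hv0, map_zero])
  have hcard := finrank_span_eq_card hli
  have hle : Submodule.span ℝ (Set.range ![w, M v]) ≤ Submodule.span ℝ S := by
    apply Submodule.span_mono
    rintro _ ⟨i, rfl⟩
    fin_cases i
    · exact hw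
    · exact hMS
  have := Submodule.finrank_mono hle
  rw [hcard] at this
  simpa [Set.finrank] using this
end
end
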